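/- arXiv:1910.01322 — 2 statements merged into one kernel-verified Lean document; each statement's English description precedes it below -/
import Mathlib

section
/- Under the standing assumptions (k ≥ 2r+13 ≥ 18; n > N_{k,r}; H a connected n-vertex r-graph with no Berge-path of length k and with at least C(⌊(k-1)/2⌋, r-1)·(n − ⌊(k-1)/2⌋) + C(⌊(k-1)/2⌋, r) + [k even]·C(⌊(k-1)/2⌋, r-2) hyperedges; H' the sub-hypergraph obtained from H by repeatedly deleting vertices of degree less than C(⌊(k-1)/2⌋, r-1) together with their incident hyperedges), the hypergraph H' is isomorphic to H_{v(H'), k}, where v(H') denotes the number of vertices of H'. -/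
open scoped Classical

/-- A Berge-path of length `t` in the hypergraph `H` (a family of hyperedges):
an alternating sequence of `t+1` distinct vertices and `t` distinct hyperedges
`v₁, e₁, …, e_t, v_{t+1}` with `vᵢ, vᵢ₊₁ ∈ eᵢ`. -/
structure BergePath {V : Type*} (H : Finset (Finset V)) (t : ℕ) where
  verts : Fin (t + 1) → V
  edges : Fin t → Finset V
  verts_inj : Function.Injective verts
  edges_inj : Function.Injective edges
  edges_mem : ∀ i, edges i ∈ H
  fst_mem : ∀ i : Fin t, verts i.castSucc ∈ edges i
  snd_mem : ∀ i : Fin t, verts i.succ ∈ edges i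

/-- A Berge-cycle of length `t` in the hypergraph `H`: `t` distinct vertices and
`t` distinct hyperedges with `vᵢ, vᵢ₊₁ ∈ eᵢ`, indices mod `t`. -/
structure BergeCycle {V : Type*} (H : Finset (Finset V)) (t : ℕ) where
  verts : Fin t → V
  edges : Fin t → Finset V
  verts_inj : Function.Injective verts
  edges_inj : Function.Injective edges
  edges_mem : ∀ i, edges i ∈ H
  fst_mem : ∀ i, verts i ∈ edges i
  snd_mem : ∀ i : Fin t, verts ⟨(i.val + 1) % t, Nat.mod_lt _ i.pos⟩ ∈ edges i

/-- `u` and `v` are joined by a Berge-path of `H`. -/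
def BergeReachable {V : Type*} (H : Finset (Finset V)) (u v : V) : Prop :=
  ∃ t, ∃ P : BergePath H t, P.verts 0 = u ∧ P.verts (Fin.last t) = v

/-- A hypergraph on the vertex type `V` is connected if any two vertices are joined
by a Berge-path. -/
def HConnected {V : Type*} (H : Finset (Finset V)) : Prop :=
  ∀ u v : V, u ≠ v → BergeReachable H u v

/-- The degree of a vertex: the number of hyperedges containing it. -/
noncomputable def hdeg {V : Type*} (H : Finset (Finset V)) (v : V) : ℕ :=
  (H.filter (fun e => v ∈ e)).card

/-- The vertex neighborhood of `v` in `H`. -/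
noncomputable def nbhd {V : Type*} [Fintype V] (H : Finset (Finset V)) (v : V) : Finset V :=
  Finset.univ.filter (fun u => u ≠ v ∧ ∃ e ∈ H, v ∈ e ∧ u ∈ e)

/-- The sub-hypergraph induced by a set `S` of vertices: all hyperedges lying inside `S`. -/
noncomputable def restrictTo {V : Type*} (H : Finset (Finset V)) (S : Finset V) :
    Finset (Finset V) :=
  H.filter (fun e => e ⊆ S)

/-- `DelProcess H D S T` : starting from the vertex set `S`, the vertex set `T` can be
reached by repeatedly deleting a vertex whose degree in the current induced
sub-hypergraph is less than `D` (together with all hyperedges containing it). -/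
inductive DelProcess {V : Type*} (H : Finset (Finset V)) (D : ℕ) :
    Finset V → Finset V → Prop
  | refl (S : Finset V) : DelProcess H D S S
  | step (S T : Finset V) (v : V) (hv : v ∈ S)
      (hd : hdeg (restrictTo H S) v < D)
      (h : DelProcess H D (S.erase v) T) : DelProcess H D S T

/-- The edge family of `H_{n,k}` for odd `k`, on vertex set `S` with kernel `A`:
all `r`-subsets of `S` having at most one vertex outside `A`. -/
noncomputable def HnkFamilyOdd {V : Type*} (r : ℕ) (S A : Finset V) : Finset (Finset V) :=
  S.powerset.filter (fun s => s.card = r ∧ (s \ A).card ≤ 1)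

/-- The edge family of `H_{n,k}` for even `k`: additionally all `r`-subsets consisting of
`b1`, `b2` and `r-2` vertices of `A`. -/
noncomputable def HnkFamilyEven {V : Type*} (r : ℕ) (S A : Finset V) (b1 b2 : V) :
    Finset (Finset V) :=
  S.powerset.filter (fun s => s.card = r ∧ ((s \ A).card ≤ 1 ∨ s \ A = {b1, b2}))

/-- `H` is (a copy of) the extremal hypergraph `H_{m,k}` on the vertex set `S`
(where `m = |S|`). Note that `⌊(k-1)/2⌋` equals `(k-1)/2` in ℕ for odd `k`,
and `(k-2)/2` for even `k`. -/
def IsHnkOn {V : Type*} (r k : ℕ) (S : Finset V) (H : Finset (Finset V)) : Prop :=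
  ∃ A ⊆ S, A.card = (k - 1) / 2 ∧
    ((Odd k ∧ H = HnkFamilyOdd r S A) ∨
     (Even k ∧ ∃ b1 ∈ S \ A, ∃ b2 ∈ S \ A, b1 ≠ b2 ∧ H = HnkFamilyEven r S A b1 b2))

/-- The extremal number of hyperedges:
`C(⌊(k-1)/2⌋, r-1)·(n − ⌊(k-1)/2⌋) + C(⌊(k-1)/2⌋, r) + [2 ∣ k]·C(⌊(k-1)/2⌋, r-2)`. -/
def extremalCount (r k n : ℕ) : ℕ :=
  ((k - 1) / 2).choose (r - 1) * (n - (k - 1) / 2) + ((k - 1) / 2).choose r +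
    (if 2 ∣ k then ((k - 1) / 2).choose (r - 2) else 0)

/-- The threshold `N_{k,r}`. -/
def Nkr (r k : ℕ) : ℕ :=
  (r * (k - 1)).choose r + ((k - 1) / 2).choose (r - 1) * ((k - 1) / 2)
    - ((k - 1) / 2).choose r - (if 2 ∣ k then ((k - 1) / 2).choose (r - 2) else 0)
    + r * (k - 1)

section CycleLists

variable {W : Type*} {Γ : SimpleGraph W}

/-- The list `l` enumerates the vertices of a closed walk without repeated vertices. -/
def IsCycleList (Γ : SimpleGraph W) (l : List W) : Prop :=
  l.Nodup ∧ l.IsChain Γ.Adj ∧ ∀ x ∈ l.head?, ∀ y ∈ l.getLast?, Γ.Adj y x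

/-- A cyclic sequence of distinct vertices in which consecutive vertices are adjacent. -/
def IsCycleMap (Γ : SimpleGraph W) {c : ℕ} (v : ZMod c → W) : Prop :=
  Function.Injective v ∧ ∀ i, Γ.Adj (v i) (v (i + 1))

theorem IsCycleList.exists_cycleMap {l : List W} (hl : IsCycleList Γ l) (hne : l ≠ []) :
    ∃ v : ZMod l.length → W, IsCycleMap Γ v := by
  have hpos : 0 < l.length := List.length_pos_iff.2 hne
  have : NeZero l.length := ⟨hpos.ne'⟩
  obtain ⟨hnd, hch, hcl⟩ := hl
  refine ⟨fun i => l[i.val]'(ZMod.val_lt i), ?_, ?_⟩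
  · intro i j hij
    have := (List.Nodup.getElem_inj_iff hnd).1 hij
    exact ZMod.val_injective _ this
  · intro i
    have hi := ZMod.val_lt i
    have hi1 : (i + 1).val = (i.val + 1) % l.length := by
      conv_lhs => rw [← ZMod.natCast_zmod_val i, ← Nat.cast_one, ← Nat.cast_add]
      rw [ZMod.val_natCast]
    by_cases h : i.val + 1 < l.length
    · have h2 : (i + 1).val = i.val + 1 := by rw [hi1, Nat.mod_eq_of_lt h]
      simp only [h2]
      exact (List.isChain_iff_getElem.1 hch) i.val h
    · have h3 : i.val + 1 = l.length := by omega
      have h2 : (i + 1).val = 0 := by rw [hi1, h3, Nat.mod_self]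
      simp only [h2]
      apply hcl
      · simp [List.head?_eq_getElem?]
      · simp [List.getLast?_eq_getElem?, ← h3]

theorem exists_cycleList_of_path {l : List W} {x : W} (hnd : (l ++ [x]).Nodup)
    (hch : (l ++ [x]).IsChain Γ.Adj) (M : Finset W) (hM : ∀ z ∈ M, z ∈ l ∧ Γ.Adj x z)
    (hne : M.Nonempty) :
    ∃ l', IsCycleList Γ l' ∧ M.card + 1 ≤ l'.length := by
  induction l with
  | nil => obtain ⟨z, hz⟩ := hne; simpa using (hM z hz).1
  | cons a l ih =>
    by_cases ha : a ∈ M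
    · refine ⟨a :: l ++ [x], ⟨hnd, hch, ?_⟩, ?_⟩
      · intro y hy z hz
        obtain rfl : a = y := by simpa using hy
        obtain rfl : x = z := by simpa [List.getLast?_cons] using hz
        exact (hM a ha).2
      · have : M ⊆ (a :: l).toFinset := fun z hz => List.mem_toFinset.2 (hM z hz).1
        have h2 := Finset.card_le_card this
        have h3 := List.toFinset_card_le (a :: l)
        simp at h2 h3 ⊢
        omega
    · apply ih
      · exact (List.nodup_cons.1 hnd).2
      · exact (List.isChain_cons.1 hch).2
      · intro z hz
        obtain ⟨h1, h2⟩ := hM z hz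
        refine ⟨?_, h2⟩
        rcases List.mem_cons.1 h1 with h | h
        · exact absurd (h ▸ hz) ha
        · exact h

/-- The `d` vertices `v p, v (p + 1), …` of a cyclic sequence. -/
def cycleArc {c : ℕ} (v : ZMod c → W) (p : ZMod c) (d : ℕ) : List W :=
  (List.range d).map (fun j : ℕ => v (p + j))

theorem length_cycleArc {c : ℕ} (v : ZMod c → W) (p : ZMod c) (d : ℕ) :
    (cycleArc v p d).length = d := by
  simp [cycleArc]

theorem mem_range_of_mem_cycleArc {c : ℕ} {v : ZMod c → W} {p : ZMod c} {d : ℕ} {z : W}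
    (h : z ∈ cycleArc v p d) : z ∈ Set.range v := by
  simp only [cycleArc, List.mem_map] at h
  obtain ⟨j, -, rfl⟩ := h
  exact ⟨_, rfl⟩

theorem mem_cycleArc {c : ℕ} {v : ZMod c → W} {p : ZMod c} {d : ℕ} {z : W} :
    z ∈ cycleArc v p d ↔ ∃ j < d, v (p + (j : ℕ)) = z := by
  simp [cycleArc]

theorem head?_cycleArc {c : ℕ} (v : ZMod c → W) (p : ZMod c) {d : ℕ} (hd : 1 ≤ d) :
    (cycleArc v p d).head? = some (v p) := by
  obtain ⟨d, rfl⟩ := Nat.exists_eq_add_of_le' hd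
  simp [cycleArc, List.range_succ_eq_map]

theorem getLast?_cycleArc {c : ℕ} (v : ZMod c → W) (p : ZMod c) (d : ℕ) :
    (cycleArc v p (d + 1)).getLast? = some (v (p + d)) := by
  simp [cycleArc, List.range_succ]

theorem nodup_cycleArc {c : ℕ} {v : ZMod c → W} (hv : Function.Injective v) (p : ZMod c) {d : ℕ}
    (hd : d ≤ c) : (cycleArc v p d).Nodup := by
  refine List.Nodup.map_on ?_ List.nodup_range
  intro i hi j hj hij
  simp only [List.mem_range] at hi hj
  have h := add_left_cancel (hv hij)
  rw [ZMod.natCast_eq_natCast_iff'] at h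
  rwa [Nat.mod_eq_of_lt (by omega), Nat.mod_eq_of_lt (by omega)] at h

theorem isChain_cycleArc {c : ℕ} {v : ZMod c → W} (hv : ∀ i, Γ.Adj (v i) (v (i + 1)))
    (p : ZMod c) (d : ℕ) : (cycleArc v p d).IsChain Γ.Adj := by
  rw [List.isChain_iff_getElem]
  intro i hi
  simp only [cycleArc, List.getElem_map, List.getElem_range]
  have := hv (p + i)
  push_cast
  rwa [add_assoc] at this

theorem IsCycleMap.comp_neg {c : ℕ} {v : ZMod c → W} (hv : IsCycleMap Γ v) :
    IsCycleMap Γ (fun i => v (-i)) := by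
  refine ⟨hv.1.comp neg_injective, fun i => ?_⟩
  have := hv.2 (-(i + 1))
  rw [show -(i + 1) + 1 = -i by ring] at this
  exact this.symm

/-- A cyclic sequence of maximum length. -/
def IsLongestCycle (Γ : SimpleGraph W) {c : ℕ} (v : ZMod c → W) : Prop :=
  IsCycleMap Γ v ∧ ∀ l, IsCycleList Γ l → l.length ≤ c

theorem IsLongestCycle.comp_neg {c : ℕ} {v : ZMod c → W} (hv : IsLongestCycle Γ v) :
    IsLongestCycle Γ (fun i => v (-i)) := ⟨hv.1.comp_neg, hv.2⟩

theorem IsLongestCycle.detour {c : ℕ} {v : ZMod c → W} (hv : IsLongestCycle Γ v) {R : List W}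
    (hnd : R.Nodup) (hch : R.IsChain Γ.Adj) (hout : ∀ z ∈ R, z ∉ Set.range v) (hne : R ≠ [])
    {p : ZMod c} {d : ℕ} (hd : 1 ≤ d) (hdc : d ≤ c)
    (hhead : ∀ y ∈ R.head?, Γ.Adj (v p) y) (hlast : ∀ y ∈ R.getLast?, Γ.Adj y (v (p + d))) :
    R.length + 1 ≤ d := by
  have hcyc : IsCycleList Γ (R ++ cycleArc v (p + d) (c - d + 1)) := by
    refine ⟨?_, ?_, ?_⟩
    · refine List.Nodup.append hnd (nodup_cycleArc hv.1.1 _ (by omega)) ?_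
      intro z hz hz'
      exact hout z hz (mem_range_of_mem_cycleArc hz')
    · refine List.isChain_append.2 ⟨hch, isChain_cycleArc hv.1.2 _ _, ?_⟩
      intro x hx y hy
      rw [head?_cycleArc _ _ (by omega)] at hy
      obtain rfl : v (p + d) = y := by simpa using hy
      exact hlast x hx
    · intro x hx y hy
      have e1 : (R ++ cycleArc v (p + d) (c - d + 1)).head? = R.head? := by
        cases R with
        | nil => exact absurd rfl hne
        | cons a l => simp
      have e2 : (R ++ cycleArc v (p + d) (c - d + 1)).getLast? = some (v p) := by
        rw [List.getLast?_append, getLast?_cycleArc]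
        have : p + d + ((c - d : ℕ) : ZMod c) = p := by
          rw [Nat.cast_sub hdc, ZMod.natCast_self]; ring
        simp [this]
      rw [e1] at hx
      rw [e2] at hy
      obtain rfl : v p = y := by simpa using hy
      exact hhead x hx
  have := hv.2 _ hcyc
  rw [List.length_append, length_cycleArc] at this
  omega

/-- `R` continues the cycle vertex `v p` to a path leaving the cycle, ending in `x`. -/
def IsOutward (Γ : SimpleGraph W) {c : ℕ} (v : ZMod c → W) (p : ZMod c) (R : List W) (x : W) :
    Prop :=
  R.Nodup ∧ (v p :: R).IsChain Γ.Adj ∧ (∀ z ∈ R, z ∉ Set.range v) ∧ R.getLast? = some x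

theorem IsOutward.mem {c : ℕ} {v : ZMod c → W} {p : ZMod c} {R : List W} {x : W}
    (h : IsOutward Γ v p R x) : x ∈ R := List.mem_of_getLast? h.2.2.2

theorem IsOutward.extend {c : ℕ} {v : ZMod c → W} {p : ZMod c} {R : List W} {x z : W}
    (h : IsOutward Γ v p R x) (hxz : Γ.Adj x z) (hz : z ∉ R) (hz' : z ∉ Set.range v) :
    IsOutward Γ v p (R ++ [z]) z := by
  obtain ⟨h1, h2, h3, h4⟩ := h
  refine ⟨?_, ?_, ?_, by simp⟩
  · rw [List.nodup_append]
    refine ⟨h1, by simp, ?_⟩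
    intro a ha b hb
    simp only [List.mem_singleton] at hb
    rintro rfl
    exact hz (hb ▸ ha)
  · rw [← List.cons_append, List.isChain_append]
    refine ⟨h2, by simp, ?_⟩
    intro a ha b hb
    have : (v p :: R).getLast? = some x := by simp [List.getLast?_cons, h4]
    rw [this] at ha
    simp at ha hb
    subst ha; subst hb; exact hxz
  · intro y hy
    rcases List.mem_append.1 hy with hy | hy
    · exact h3 y hy
    · simp at hy; exact hy ▸ hz'

theorem IsOutward.length_add_le {c k : ℕ} {v : ZMod c → W} {p : ZMod c} {R : List W} {x : W}
    (hc : 1 ≤ c) (hv : IsCycleMap Γ v) (h : IsOutward Γ v p R x)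
    (hk : ∀ l : List W, l.Nodup → l.IsChain Γ.Adj → l.length ≤ k) : c + R.length ≤ k := by
  obtain ⟨h1, h2, h3, h4⟩ := h
  have := hk (cycleArc v (p + 1) c ++ R) ?_ ?_
  · rwa [List.length_append, length_cycleArc] at this
  · refine List.Nodup.append (nodup_cycleArc hv.1 _ le_rfl) h1 ?_
    intro z hz hz'
    exact h3 z hz' (mem_range_of_mem_cycleArc hz)
  · rw [List.isChain_cons] at h2
    refine List.isChain_append.2 ⟨isChain_cycleArc hv.2 _ _, h2.2, ?_⟩
    intro a ha b hb
    obtain ⟨m, rfl⟩ := Nat.exists_eq_add_of_le' hc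
    rw [getLast?_cycleArc] at ha
    have e : p + 1 + (m : ZMod (m + 1)) = p := by
      have := ZMod.natCast_self (m + 1)
      push_cast at this
      rw [add_assoc, add_comm 1, this, add_zero]
    rw [e] at ha
    obtain rfl : v p = a := by simpa using ha
    exact h2.1 b hb

theorem exists_outward {c : ℕ} {v : ZMod c → W}
    (hconn : ∀ Y : Set W, Y.Nonempty → Yᶜ.Nonempty → ∃ a ∈ Y, ∃ b ∈ Yᶜ, Γ.Adj a b)
    {u : W} (hu : u ∉ Set.range v) : ∃ p R, IsOutward Γ v p R u := by
  by_contra hcon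
  let Y : Set W := Set.range v ∪ {z | ∃ p R, IsOutward Γ v p R z}
  obtain ⟨a, ha, b, hb, hab⟩ := hconn Y ⟨v 0, Or.inl ⟨0, rfl⟩⟩
    ⟨u, fun h => h.elim hu hcon⟩
  apply hb
  have hb' : b ∉ Set.range v := fun h => hb (Or.inl h)
  right
  rcases ha with ⟨p, rfl⟩ | ⟨p, R, hR⟩
  · exact ⟨p, [b], by simp, by simpa using hab, by simpa using hb', by simp⟩
  · by_cases hbR : b ∈ R
    · obtain ⟨l1, l2, rfl⟩ := List.append_of_mem hbR
      obtain ⟨h1, h2, h3, h4⟩ := hR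
      refine ⟨p, l1 ++ [b], ?_, ?_, ?_, by simp⟩
      · have : (l1 ++ [b]) ++ l2 = l1 ++ b :: l2 := by simp
        rw [← this] at h1
        exact h1.of_append_left
      · have : (v p :: (l1 ++ [b])) ++ l2 = v p :: (l1 ++ b :: l2) := by simp
        rw [← this] at h2
        exact h2.left_of_append
      · intro z hz
        apply h3
        simp at hz ⊢
        tauto
    · exact ⟨p, R ++ [b], hR.extend hab hbR hb'⟩

end CycleLists

section LongestCycle

variable {W : Type*} {Γ : SimpleGraph W}

theorem IsLongestCycle.detour_neg {c : ℕ} {v : ZMod c → W} (hv : IsLongestCycle Γ v) {R : List W}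
    (hnd : R.Nodup) (hch : R.IsChain Γ.Adj) (hout : ∀ z ∈ R, z ∉ Set.range v) (hne : R ≠ [])
    {p : ZMod c} {d : ℕ} (hd : 1 ≤ d) (hdc : d ≤ c)
    (hhead : ∀ y ∈ R.head?, Γ.Adj (v p) y) (hlast : ∀ y ∈ R.getLast?, Γ.Adj y (v (p - d))) :
    R.length + 1 ≤ d := by
  refine hv.comp_neg.detour (p := -p) hnd hch ?_ hne hd hdc ?_ ?_
  · rintro z hz ⟨i, hi⟩
    exact hout z hz ⟨_, hi⟩
  · simpa using hhead
  · intro y hy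
    have := hlast y hy
    rwa [show p - (d : ZMod c) = -(-p + d) by ring] at this

theorem IsLongestCycle.not_adj_succ {c : ℕ} (hc : 1 ≤ c) {v : ZMod c → W}
    (hv : IsLongestCycle Γ v) {x : W} (hx : x ∉ Set.range v) {i : ZMod c}
    (hi : Γ.Adj x (v i)) : ¬ Γ.Adj x (v (i + 1)) := by
  intro h
  have := hv.detour (R := [x]) (p := i) (d := 1) (by simp) (by simp) (by simpa using hx) (by simp)
    le_rfl hc (by simpa using hi.symm) (by simpa using h)
  simp at this

theorem two_mul_card_le_of_no_consecutive {I : Finset ℕ} {a b : ℕ}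
    (hI : ∀ d ∈ I, a ≤ d ∧ d < b) (hcons : ∀ d ∈ I, d + 1 ∉ I) : 2 * I.card ≤ b + 1 - a := by
  have hdis : Disjoint I (I.image (· + 1)) := by
    rw [Finset.disjoint_left]
    intro d hd hd'
    obtain ⟨e, he, rfl⟩ := Finset.mem_image.1 hd'
    exact hcons e he hd
  have hsub : I ∪ I.image (· + 1) ⊆ Finset.Icc a b := by
    intro d hd
    rw [Finset.mem_Icc]
    rcases Finset.mem_union.1 hd with hd | hd
    · have := hI d hd; omega
    · obtain ⟨e, he, rfl⟩ := Finset.mem_image.1 hd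
      have := hI e he; omega
  have h1 := Finset.card_le_card hsub
  rw [Finset.card_union_of_disjoint hdis,
    Finset.card_image_of_injective _ (add_left_injective 1), Nat.card_Icc] at h1
  omega

theorem IsLongestCycle.outward_nbrs {c : ℕ} (hc : 1 ≤ c) {v : ZMod c → W}
    (hv : IsLongestCycle Γ v) {p : ZMod c} {R : List W} {x : W} (h : IsOutward Γ v p R x)
    (M : Finset W) (hM : ∀ z ∈ M, Γ.Adj x z ∧ (z ∈ R ∨ z ∈ Set.range v)) :
    (∀ z ∈ M, z ∈ R ∨ z = v p) ∨ 2 * M.card ≤ c := by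
  have hxR := h.mem
  obtain ⟨h1, h2, h3, h4⟩ := h
  have hR : R ≠ [] := by rintro rfl; simp at hxR
  have hxv : x ∉ Set.range v := h3 x hxR
  rw [List.isChain_cons] at h2
  have : NeZero c := ⟨by omega⟩
  let I : Finset ℕ := (Finset.range c).filter (fun d => 1 ≤ d ∧ v (p + d) ∈ M)
  have hlo : ∀ d ∈ I, R.length + 1 ≤ d ∧ d < c - R.length := by
    intro d hd
    simp only [I, Finset.mem_filter, Finset.mem_range] at hd
    obtain ⟨hd1, hd2, hd3⟩ := hd
    have hadj := (hM _ hd3).1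
    have e1 := hv.detour (p := p) (d := d) h1 h2.2 h3 hR hd2 hd1.le h2.1
      (by rw [h4]; intro y hy; simp at hy; subst hy; exact hadj)
    have e2 := hv.detour_neg (p := p) (d := c - d) h1 h2.2 h3 hR (by omega) (by omega) h2.1
      (by
        rw [h4]; intro y hy; simp at hy; subst hy
        rw [Nat.cast_sub hd1.le, ZMod.natCast_self]
        simpa using hadj)
    omega
  have hcover : M ⊆ (insert (v p) (R.toFinset.erase x)) ∪ I.image (fun d : ℕ => v (p + d)) := by
    intro z hz
    obtain ⟨hz1, hz2⟩ := hM z hz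
    rcases hz2 with hz2 | ⟨i, rfl⟩
    · have : z ≠ x := hz1.ne'
      simp [hz2, this]
    · by_cases hi : i = p
      · simp [hi]
      · apply Finset.mem_union_right
        refine Finset.mem_image.2 ⟨(i - p).val, ?_, by simp⟩
        simp only [I, Finset.mem_filter, Finset.mem_range]
        refine ⟨ZMod.val_lt _, ?_, by simpa using hz⟩
        have : (i - p).val ≠ 0 := by
          rw [Ne, ZMod.val_eq_zero, sub_eq_zero]; exact hi
        omega
  by_cases hI : I = ∅
  · left
    intro z hz
    have := hcover hz
    simp [hI] at this
    tauto
  · right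
    obtain ⟨d0, hd0⟩ := Finset.nonempty_iff_ne_empty.2 hI
    have hd0' := hlo d0 hd0
    have hcard := two_mul_card_le_of_no_consecutive (I := I) (a := R.length + 1)
      (b := c - R.length) hlo (by
        intro d hd hd'
        simp only [I, Finset.mem_filter, Finset.mem_range] at hd hd'
        refine hv.not_adj_succ hc hxv (hM _ hd.2.2).1 ?_
        have := (hM _ hd'.2.2).1
        push_cast at this
        rwa [add_assoc])
    have e1 := Finset.card_le_card hcover
    have e2 := Finset.card_union_le (insert (v p) (R.toFinset.erase x))
      (I.image (fun d : ℕ => v (p + d)))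
    have e3 := Finset.card_image_le (s := I) (f := fun d : ℕ => v (p + d))
    have e4 := Finset.card_insert_le (v p) (R.toFinset.erase x)
    have e5 := Finset.card_erase_of_mem (List.mem_toFinset.2 hxR)
    have e6 := List.toFinset_card_le R
    have e7 : 0 < R.length := List.length_pos_iff.2 hR
    omega

theorem IsLongestCycle.card_le_of_outward {c : ℕ} {v : ZMod c → W}
    (hv : IsLongestCycle Γ v) {p : ZMod c} {R : List W} {x : W} (h : IsOutward Γ v p R x)
    (M : Finset W) (hne : M.Nonempty) (hM : ∀ z ∈ M, Γ.Adj x z ∧ (z ∈ R ∨ z = v p)) :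
    M.card ≤ R.length ∧ M.card + 1 ≤ c := by
  have hxR := h.mem
  obtain ⟨h1, h2, h3, h4⟩ := h
  have hR : R ≠ [] := by rintro rfl; simp at hxR
  constructor
  · have : M ⊆ insert (v p) (R.toFinset.erase x) := by
      intro z hz
      obtain ⟨hz1, hz2⟩ := hM z hz
      have : z ≠ x := hz1.ne'
      rcases hz2 with h | h <;> simp [h, this]
    have e1 := Finset.card_le_card this
    have e4 := Finset.card_insert_le (v p) (R.toFinset.erase x)
    have e5 := Finset.card_erase_of_mem (List.mem_toFinset.2 hxR)
    have e6 := List.toFinset_card_le R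
    have e7 : 0 < R.length := List.length_pos_iff.2 hR
    omega
  · obtain ⟨R0, rfl⟩ : ∃ R0, R = R0 ++ [x] := List.getLast?_eq_some_iff.1 h4
    have hvp : v p ∉ R0 ++ [x] := fun hh => h3 _ hh ⟨p, rfl⟩
    obtain ⟨l', hcyc, hcard⟩ := exists_cycleList_of_path (Γ := Γ) (l := v p :: R0) (x := x)
      (by rw [List.cons_append, List.nodup_cons]; exact ⟨hvp, h1⟩) h2 M
      (by
        intro z hz
        obtain ⟨hz1, hz2⟩ := hM z hz
        refine ⟨?_, hz1⟩
        have : z ≠ x := hz1.ne'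
        simp at hz2 ⊢
        tauto) hne
    exact hcard.trans (hv.2 _ hcyc)

/-- A longest path leaving the cycle among those ending in a prescribed set. -/
theorem exists_longest_outward {c k : ℕ} {v : ZMod c → W} (hc : 1 ≤ c) (hv : IsCycleMap Γ v)
    (hk : ∀ l : List W, l.Nodup → l.IsChain Γ.Adj → l.length ≤ k)
    (hconn : ∀ Y : Set W, Y.Nonempty → Yᶜ.Nonempty → ∃ a ∈ Y, ∃ b ∈ Yᶜ, Γ.Adj a b)
    {U : Finset W} {u : W} (huU : u ∈ U) (hu : u ∉ Set.range v) :
    ∃ p R x, x ∈ U ∧ IsOutward Γ v p R x ∧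
      ∀ p' R' x', x' ∈ U → IsOutward Γ v p' R' x' → R'.length ≤ R.length := by
  let P : ℕ → Prop := fun m => ∃ p R x, x ∈ U ∧ IsOutward Γ v p R x ∧ R.length = m
  obtain ⟨p0, R0, h0⟩ := exists_outward hconn hu
  have hb : ∀ m, P m → m ≤ k := by
    rintro m ⟨p, R, x, -, hR, rfl⟩
    have := hR.length_add_le hc hv hk
    omega
  have hP0 : P R0.length := ⟨p0, R0, u, huU, h0, rfl⟩
  obtain ⟨p, R, x, hx, hR, hRl⟩ := Nat.findGreatest_spec (P := P) (hb _ hP0) hP0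
  refine ⟨p, R, x, hx, hR, fun p' R' x' hx' hR' => ?_⟩
  have hP' : P R'.length := ⟨p', R', x', hx', hR', rfl⟩
  rw [hRl]
  exact Nat.le_findGreatest (hb _ hP') hP'

theorem nbr_mem_of_longest_outward {c : ℕ} {v : ZMod c → W} {U : Finset W} {p : ZMod c}
    {R : List W} {x z : W} (hR : IsOutward Γ v p R x)
    (hmax : ∀ p' R' x', x' ∈ U → IsOutward Γ v p' R' x' → R'.length ≤ R.length)
    (hz : z ∈ U) (hxz : Γ.Adj x z) : z ∈ R ∨ z ∈ Set.range v := by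
  by_contra hcon
  push Not at hcon
  have := hmax _ _ _ hz (hR.extend hxz hcon.1 hcon.2)
  simp at this

/-- The vertices outside a longest cycle can be removed one at a time, each having at most `s`
neighbours among the vertices still present. -/
theorem IsLongestCycle.weight_le {c k s D : ℕ} [Fintype W] {v : ZMod c → W} (hc : 1 ≤ c)
    (hv : IsLongestCycle Γ v) (hks : k ≤ 2 * s + 2) (hck : c + 1 ≤ k)
    (hk : ∀ l : List W, l.Nodup → l.IsChain Γ.Adj → l.length ≤ k)
    (hconn : ∀ Y : Set W, Y.Nonempty → Yᶜ.Nonempty → ∃ a ∈ Y, ∃ b ∈ Yᶜ, Γ.Adj a b)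
    (w : Finset W → ℕ)
    (hw : ∀ U : Finset W, ∀ x ∈ U, (U.filter (Γ.Adj x)).card ≤ s → w U ≤ w (U.erase x) + D)
    (C : Finset W) (hC : ∀ x, x ∈ C ↔ x ∈ Set.range v) (m : ℕ) (U : Finset W) (hCU : C ⊆ U)
    (hUm : U.card = C.card + m) : w U ≤ w C + D * m := by
  induction m generalizing U with
  | zero =>
    have : C = U := Finset.eq_of_subset_of_card_le hCU (by omega)
    simp [this]
  | succ m ih =>
    obtain ⟨u, huU, huC⟩ : ∃ u ∈ U, u ∉ C := by
      by_contra hcon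
      push Not at hcon
      have := Finset.card_le_card (show U ⊆ C from hcon)
      omega
    obtain ⟨p, R, x, hxU, hR, hmax⟩ := exists_longest_outward hc hv.1 hk hconn huU
      (fun h => huC ((hC u).2 h))
    have hxC : x ∉ C := fun h => hR.2.2.1 x hR.mem ((hC x).1 h)
    have hlen := hR.length_add_le hc hv.1 hk
    have hdeg : (U.filter (Γ.Adj x)).card ≤ s := by
      by_contra hcon
      push Not at hcon
      have hM : ∀ z ∈ U.filter (Γ.Adj x), Γ.Adj x z ∧ (z ∈ R ∨ z ∈ Set.range v) := by
        intro z hz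
        rw [Finset.mem_filter] at hz
        exact ⟨hz.2, nbr_mem_of_longest_outward hR hmax hz.1 hz.2⟩
      rcases hv.outward_nbrs hc hR _ hM with h | h
      · have := hv.card_le_of_outward hR _ (Finset.card_pos.1 (by omega))
          (fun z hz => ⟨(hM z hz).1, h z hz⟩)
        omega
      · omega
    have h1 := hw U x hxU hdeg
    have h2 := ih (U.erase x) (fun y hy => Finset.mem_erase.2 ⟨fun h => hxC (h ▸ hy), hCU hy⟩)
      (by rw [Finset.card_erase_of_mem hxU]; omega)
    rw [Nat.mul_succ]
    omega

end LongestCycle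

section CycleNeighbours

variable {W : Type*} {Γ : SimpleGraph W}

/-- A longest outward path with `s` vertices whose end has degree at least `s`: its last two
vertices can be swapped, so one of them loses a neighbour when the other is removed. -/
theorem IsLongestCycle.weight_lt {c k s D : ℕ} [Fintype W] {v : ZMod c → W}
    (hv : IsLongestCycle Γ v) (hks : k ≤ 2 * s + 2) (hck : c + s ≤ k) (hs : 4 ≤ s)
    (hcs : s + 1 ≤ c) (hc2 : c < 2 * s) (hmaxk : k < c + s + 1)
    (hk : ∀ l : List W, l.Nodup → l.IsChain Γ.Adj → l.length ≤ k)
    (hconn : ∀ Y : Set W, Y.Nonempty → Yᶜ.Nonempty → ∃ a ∈ Y, ∃ b ∈ Yᶜ, Γ.Adj a b)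
    (hdeg : ∀ x, s ≤ (Finset.univ.filter (Γ.Adj x)).card)
    (w : Finset W → ℕ)
    (hw : ∀ U : Finset W, ∀ x ∈ U, (U.filter (Γ.Adj x)).card ≤ s → w U ≤ w (U.erase x) + D)
    (hw' : ∀ U : Finset W, ∀ x ∈ U, (U.filter (Γ.Adj x)).card ≤ s - 1 →
      w U + 1 ≤ w (U.erase x) + D)
    (C : Finset W) (hC : ∀ x, x ∈ C ↔ x ∈ Set.range v) (m : ℕ)
    (hm : Fintype.card W = C.card + m) (hm0 : 0 < m) : w Finset.univ + 1 ≤ w C + D * m := by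
  have hc : 1 ≤ c := by omega
  obtain ⟨u, huC⟩ : ∃ u, u ∉ C := by
    by_contra hcon
    push Not at hcon
    have := Finset.card_le_card (show Finset.univ ⊆ C from fun x _ => hcon x)
    rw [Finset.card_univ] at this
    omega
  obtain ⟨p, R, x, -, hR, hmax⟩ := exists_longest_outward hc hv.1 hk hconn
    (Finset.mem_univ u) (fun h => huC ((hC u).2 h))
  have hlen := hR.length_add_le hc hv.1 hk
  -- the end of any outward path of maximum length sees only that path
  have key : ∀ R' x', IsOutward Γ v p R' x' → R'.length = R.length →
      ∀ z, Γ.Adj x' z → z ∈ R' ∨ z = v p := by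
    intro R' x' hR' hl
    have hM : ∀ z ∈ Finset.univ.filter (Γ.Adj x'), Γ.Adj x' z ∧ (z ∈ R' ∨ z ∈ Set.range v) := by
      intro z hz
      rw [Finset.mem_filter] at hz
      refine ⟨hz.2, nbr_mem_of_longest_outward (U := Finset.univ) hR' ?_ hz.1 hz.2⟩
      rw [hl]; exact hmax
    rcases hv.outward_nbrs hc hR' _ hM with h | h
    · intro z hz
      exact h z (by simpa using hz)
    · have := hdeg x'
      omega
  have hx := key R x hR rfl
  have hcard := hv.card_le_of_outward hR (Finset.univ.filter (Γ.Adj x))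
    (Finset.card_pos.1 (by have := hdeg x; omega))
    (fun z hz => ⟨(Finset.mem_filter.1 hz).2, hx z (Finset.mem_filter.1 hz).2⟩)
  have hRs : R.length = s := by have := hdeg x; omega
  obtain ⟨R1, rfl⟩ : ∃ R1, R = R1 ++ [x] := List.getLast?_eq_some_iff.1 hR.2.2.2
  have hR1 : R1 ≠ [] := by rintro rfl; simp at hRs; omega
  obtain ⟨R0, x', rfl⟩ : ∃ R0 x', R1 = R0 ++ [x'] :=
    ⟨_, _, (List.dropLast_append_getLast hR1).symm⟩
  have hR0 : R0.length + 2 = s := by simp at hRs; omega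
  -- all the earlier vertices are neighbours of `x`
  have hall : ∀ z, z ∈ v p :: (R0 ++ [x']) → Γ.Adj x z := by
    have hsub : Finset.univ.filter (Γ.Adj x) ⊆ (v p :: (R0 ++ [x'])).toFinset := by
      intro z hz
      have hz' := (Finset.mem_filter.1 hz).2
      have := hx z hz'
      have hne : z ≠ x := hz'.ne'
      simp at this ⊢
      tauto
    have h2 := List.toFinset_card_le (v p :: (R0 ++ [x']))
    have h3 : (v p :: (R0 ++ [x'])).length = s := by simp; omega
    have heq := Finset.eq_of_subset_of_card_le hsub (by have := hdeg x; omega)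
    intro z hz
    have : z ∈ Finset.univ.filter (Γ.Adj x) := by rw [heq]; exact List.mem_toFinset.2 hz
    exact (Finset.mem_filter.1 this).2
  have hR' : IsOutward Γ v p (R0 ++ [x, x']) x' := by
    obtain ⟨h1, h2, h3, h4⟩ := hR
    refine ⟨?_, ?_, ?_, by simp [List.getLast?_append]⟩
    · have hp : List.Perm (R0 ++ [x, x']) (R0 ++ [x'] ++ [x]) := by
        rw [List.append_assoc]
        exact List.Perm.append_left _ (List.Perm.swap _ _ _)
      exact hp.nodup_iff.2 h1
    · have e : v p :: (R0 ++ [x, x']) = (v p :: R0) ++ [x, x'] := rfl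
      have e' : v p :: (R0 ++ [x'] ++ [x]) = (v p :: R0) ++ ([x'] ++ [x]) := by simp
      rw [e'] at h2
      rw [e, List.isChain_append]
      refine ⟨h2.left_of_append, ?_, ?_⟩
      · simpa using hall x' (by simp)
      · intro a ha b hb
        obtain rfl : x = b := by simpa using hb
        have ha' := List.mem_of_getLast? ha
        exact (hall a (by simp at ha' ⊢; tauto)).symm
    · intro z hz
      apply h3
      simp at hz ⊢
      tauto
  have hx' := key _ _ hR' (by simp)
  have hdx : ((Finset.univ : Finset W).filter (Γ.Adj x)).card ≤ s := by omega
  have hnd := hR.1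
  have hxx' : x' ≠ x := by
    rintro rfl
    simp [List.nodup_append] at hnd
  have hdx' : ((Finset.univ.erase x).filter (Γ.Adj x')).card ≤ s - 1 := by
    have hsub : (Finset.univ.erase x).filter (Γ.Adj x') ⊆ (v p :: R0).toFinset := by
      intro z hz
      rw [Finset.mem_filter, Finset.mem_erase] at hz
      have := hx' z hz.2
      have hne : z ≠ x' := hz.2.ne'
      simp at this ⊢
      tauto
    have h1 := Finset.card_le_card hsub
    have h2 := List.toFinset_card_le (v p :: R0)
    simp only [List.length_cons] at h2
    omega
  have hxC : x ∉ C := fun h => hR.2.2.1 x hR.mem ((hC x).1 h)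
  have hxC' : x' ∉ C := fun h => hR'.2.2.1 x' hR'.mem ((hC x').1 h)
  have hmem : x' ∈ Finset.univ.erase x := Finset.mem_erase.2 ⟨hxx', Finset.mem_univ _⟩
  have hcardU : ((Finset.univ.erase x).erase x').card = Fintype.card W - 2 := by
    rw [Finset.card_erase_of_mem hmem, Finset.card_erase_of_mem (Finset.mem_univ _),
      Finset.card_univ]
    omega
  have hCU : C ⊆ (Finset.univ.erase x).erase x' := by
    intro y hy
    refine Finset.mem_erase.2 ⟨fun h => hxC' (h ▸ hy), Finset.mem_erase.2
      ⟨fun h => hxC (h ▸ hy), Finset.mem_univ _⟩⟩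
  have hcle := Finset.card_le_card hCU
  have h2m : 2 ≤ m := by
    have : (insert x (insert x' C)).card ≤ Fintype.card W := Finset.card_le_univ _
    rw [Finset.card_insert_of_notMem, Finset.card_insert_of_notMem hxC'] at this
    · omega
    · simp [hxx'.symm, hxC]
  obtain ⟨m, rfl⟩ := Nat.exists_eq_add_of_le' h2m
  have f1 := hw Finset.univ x (Finset.mem_univ _) hdx
  have f2 := hw' _ x' hmem hdx'
  have f3 := hv.weight_le hc hks (by omega) hk hconn w hw C hC m _ hCU (by omega)
  have : D * (m + 2) = D * m + D + D := by ring
  omega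

theorem IsLongestCycle.two_mul_card_le {c : ℕ} [NeZero c] {v : ZMod c → W}
    (hv : IsLongestCycle Γ v) {x : W} (hx : x ∉ Set.range v) :
    2 * (Finset.univ.filter (fun i => Γ.Adj x (v i))).card ≤ c ∧
    ((Finset.univ.filter (fun i => Γ.Adj x (v i))) ∪
      (Finset.univ.filter (fun i => Γ.Adj x (v (i - 1))))).card =
        2 * (Finset.univ.filter (fun i => Γ.Adj x (v i))).card := by
  have hc : 1 ≤ c := Nat.one_le_iff_ne_zero.2 (NeZero.ne c)
  set I := Finset.univ.filter (fun i => Γ.Adj x (v i)) with hI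
  set J := Finset.univ.filter (fun i => Γ.Adj x (v (i - 1))) with hJ
  have hdis : Disjoint I J := by
    rw [Finset.disjoint_left]
    intro i hi hi'
    simp only [hI, hJ, Finset.mem_filter, Finset.mem_univ, true_and] at hi hi'
    exact hv.not_adj_succ hc hx hi' (by simpa using hi)
  have hcard : J.card = I.card := by
    have : J = I.image (fun i => i + 1) := by
      ext i
      simp only [hI, hJ, Finset.mem_filter, Finset.mem_univ, true_and, Finset.mem_image]
      constructor
      · intro h; exact ⟨i - 1, h, by ring⟩
      · rintro ⟨j, hj, rfl⟩; simpa using hj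
    rw [this, Finset.card_image_of_injective _ (add_left_injective 1)]
  have h1 := Finset.card_union_of_disjoint hdis
  have h2 := Finset.card_le_univ (I ∪ J)
  rw [ZMod.card] at h2
  omega

theorem card_nbrs_le_card_indices {c : ℕ} [NeZero c] [Fintype W] {v : ZMod c → W} {x : W}
    (Z : Finset W) (hZ : ∀ z, Γ.Adj x z → z ∈ Z ∨ z ∈ Set.range v) :
    (Finset.univ.filter (Γ.Adj x)).card ≤
      Z.card + (Finset.univ.filter (fun i => Γ.Adj x (v i))).card := by
  have : Finset.univ.filter (Γ.Adj x) ⊆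
      Z ∪ (Finset.univ.filter (fun i => Γ.Adj x (v i))).image v := by
    intro z hz
    have hz' := (Finset.mem_filter.1 hz).2
    rcases hZ z hz' with h | ⟨i, rfl⟩
    · exact Finset.mem_union_left _ h
    · exact Finset.mem_union_right _ (Finset.mem_image.2 ⟨i, by simpa using hz', rfl⟩)
  have h1 := Finset.card_le_card this
  have h2 := Finset.card_union_le Z ((Finset.univ.filter (fun i => Γ.Adj x (v i))).image v)
  have h3 := Finset.card_image_le (s := Finset.univ.filter (fun i => Γ.Adj x (v i))) (f := v)
  omega

theorem IsLongestCycle.outside_indep {c k s : ℕ} [Fintype W] {v : ZMod c → W}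
    (hv : IsLongestCycle Γ v) (hks : k ≤ 2 * s + 2) (hs : 4 ≤ s) (hcs : 2 * s ≤ c)
    (hk : ∀ l : List W, l.Nodup → l.IsChain Γ.Adj → l.length ≤ k)
    (hconn : ∀ Y : Set W, Y.Nonempty → Yᶜ.Nonempty → ∃ a ∈ Y, ∃ b ∈ Yᶜ, Γ.Adj a b)
    (hdeg : ∀ x, s ≤ (Finset.univ.filter (Γ.Adj x)).card)
    {u z : W} (hu : u ∉ Set.range v) (huz : Γ.Adj u z) : z ∈ Set.range v := by
  have hc : 1 ≤ c := by omega
  have : NeZero c := ⟨by omega⟩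
  by_contra hz
  obtain ⟨p, R, hR⟩ := exists_outward hconn hu
  have hlen : ∀ {p R x}, IsOutward Γ v p R x → c + R.length ≤ k :=
    fun hR => hR.length_add_le hc hv.1 hk
  have hex : ∃ p a b, IsOutward Γ v p [a, b] b := by
    have h1 := hlen hR
    match R, hR with
    | [], hR => simpa using hR.mem
    | [a], hR =>
      have ha : a = u := by simpa using hR.2.2.2
      subst ha
      exact ⟨p, a, z, hR.extend huz (by simpa using huz.ne') hz⟩
    | [a, b], hR =>
      have ha : b = u := by simpa using hR.2.2.2
      subst ha
      exact ⟨p, a, b, hR⟩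
    | a :: b :: d :: R, hR =>
      simp at h1
      omega
  obtain ⟨p, a, b, hab⟩ := hex
  have hclen := hlen hab
  simp at hclen
  have hnd := hab.1
  simp at hnd
  have hout := hab.2.2.1
  have ha : a ∉ Set.range v := hout a (by simp)
  have hb : b ∉ Set.range v := hout b (by simp)
  have habadj : Γ.Adj a b := by
    have := hab.2.1
    simp at this
    exact this.2
  have hNb : ∀ z, Γ.Adj b z → z ∈ ({a} : Finset W) ∨ z ∈ Set.range v := by
    intro y hy
    by_contra hcon
    push Not at hcon
    have hya : y ≠ a := by simpa using hcon.1
    have := hlen (hab.extend hy (by simp [hya, hy.ne']) hcon.2)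
    simp at this
    omega
  have hb1 := card_nbrs_le_card_indices (Γ := Γ) _ hNb
  have hb2 := hdeg b
  simp only [Finset.card_singleton] at hb1
  obtain ⟨j, hj⟩ : (Finset.univ.filter (fun i => Γ.Adj b (v i))).Nonempty :=
    Finset.card_pos.1 (by omega)
  simp only [Finset.mem_filter, Finset.mem_univ, true_and] at hj
  have hba : IsOutward Γ v j [b, a] a := by
    refine ⟨by simp [Ne.symm hnd], by simpa using ⟨hj.symm, habadj.symm⟩, ?_, by simp⟩
    intro y hy
    simp at hy
    rcases hy with rfl | rfl <;> assumption
  have hNa : ∀ z, Γ.Adj a z → z ∈ ({b} : Finset W) ∨ z ∈ Set.range v := by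
    intro y hy
    by_contra hcon
    push Not at hcon
    have hya : y ≠ b := by simpa using hcon.1
    have := hlen (hba.extend hy (by simp [hya, hy.ne']) hcon.2)
    simp at this
    omega
  have ha1 := card_nbrs_le_card_indices (Γ := Γ) _ hNa
  have ha2 := hdeg a
  simp only [Finset.card_singleton] at ha1
  set Ia := Finset.univ.filter (fun i => Γ.Adj a (v i)) with hIa
  set Ib := Finset.univ.filter (fun i => Γ.Adj b (v i)) with hIb
  have hnot : ∀ i, Γ.Adj a (v i) → ∀ d : ℕ, 1 ≤ d → d ≤ 2 → ¬ Γ.Adj b (v (i + d)) := by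
    intro i hi d hd1 hd2 hbd
    have := hv.detour (R := [a, b]) (p := i) (d := d) hab.1 (by simpa using habadj) hout (by simp)
      hd1 (by omega) (by simpa using hi.symm) (by simpa using hbd)
    simp at this
    omega
  have hsub1 : Disjoint (Ia.image (· + 1) ∪ Ia.image (· + 2)) Ib := by
    rw [Finset.disjoint_left]
    intro i hi hi'
    simp only [hIb, Finset.mem_filter, Finset.mem_univ, true_and] at hi'
    simp only [hIa, Finset.mem_union, Finset.mem_image, Finset.mem_filter, Finset.mem_univ,
      true_and] at hi
    rcases hi with ⟨q, hq, rfl⟩ | ⟨q, hq, rfl⟩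
    · exact hnot q hq 1 le_rfl (by norm_num) (by simpa using hi')
    · exact hnot q hq 2 (by norm_num) le_rfl (by simpa using hi')
  have hsub2 : Disjoint (Ia.image (· + 1)) (Ia.image (· + 2)) := by
    rw [Finset.disjoint_left]
    intro i hi hi'
    simp only [hIa, Finset.mem_image, Finset.mem_filter, Finset.mem_univ, true_and] at hi hi'
    obtain ⟨q, hq, rfl⟩ := hi
    obtain ⟨q', hq', hqq⟩ := hi'
    obtain rfl : q = q' + 1 := by linear_combination -hqq
    exact hv.not_adj_succ hc ha hq' hq
  have hcd := Finset.card_le_univ (Ia.image (· + 1) ∪ Ia.image (· + 2) ∪ Ib)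
  rw [Finset.card_union_of_disjoint hsub1, Finset.card_union_of_disjoint hsub2,
    Finset.card_image_of_injective _ (add_left_injective 1),
    Finset.card_image_of_injective _ (add_left_injective 2), ZMod.card] at hcd
  omega

theorem zmod_natCast_ne_zero {c m : ℕ} (h0 : 0 < m) (h1 : m < c) : (m : ZMod c) ≠ 0 := by
  rw [Ne, ZMod.natCast_eq_zero_iff]
  exact fun h => absurd (Nat.le_of_dvd h0 h) (by omega)

theorem IsLongestCycle.update {c : ℕ} {v : ZMod c → W} (hv : IsLongestCycle Γ v) (hc : 2 ≤ c)
    {x : W} (hx : x ∉ Set.range v) {j : ZMod c} (h1 : Γ.Adj x (v (j - 1)))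
    (h2 : Γ.Adj x (v (j + 1))) :
    IsLongestCycle Γ (Function.update v j x) := by
  have h10 : (1 : ZMod c) ≠ 0 := by
    simpa using zmod_natCast_ne_zero (c := c) (m := 1) (by omega) (by omega)
  refine ⟨⟨?_, ?_⟩, hv.2⟩
  · intro a b hab
    by_cases ha : a = j <;> by_cases hb : b = j
    · rw [ha, hb]
    · subst ha
      rw [Function.update_self, Function.update_of_ne hb] at hab
      exact absurd ⟨b, hab.symm⟩ hx
    · subst hb
      rw [Function.update_self, Function.update_of_ne ha] at hab
      exact absurd ⟨a, hab⟩ hx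
    · rw [Function.update_of_ne ha, Function.update_of_ne hb] at hab
      exact hv.1.1 hab
  · intro i
    by_cases hi : i = j
    · subst hi
      rw [Function.update_self, Function.update_of_ne (by simpa using h10)]
      exact h2
    · rw [Function.update_of_ne hi]
      by_cases hi' : i + 1 = j
      · subst hi'
        rw [Function.update_self]
        simpa using h1.symm
      · rw [Function.update_of_ne hi']
        exact hv.1.2 i

theorem notMem_range_update {c : ℕ} {v : ZMod c → W} (hv : Function.Injective v)
    {x u : W} {j : ZMod c} (hux : u ≠ x) (hu : u ∉ Set.range v ∨ u = v j) :
    u ∉ Set.range (Function.update v j x) := by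
  rintro ⟨i, hi⟩
  by_cases hij : i = j
  · subst hij
    rw [Function.update_self] at hi
    exact hux hi.symm
  · rw [Function.update_of_ne hij] at hi
    rcases hu with hu | rfl
    · exact hu ⟨i, hi⟩
    · exact hij (hv hi)

end CycleNeighbours

section Structure

variable {W : Type*} [Fintype W] {Γ : SimpleGraph W}

/-- A connected graph of minimum degree at least `s` in which every path has at most
`k ≤ 2 s + 2` vertices. -/
structure PathBounded (Γ : SimpleGraph W) (s k : ℕ) : Prop where
  four_le : 4 ≤ s
  le_k : 2 * s + 1 ≤ k
  k_le : k ≤ 2 * s + 2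
  path_le : ∀ l : List W, l.Nodup → l.IsChain Γ.Adj → l.length ≤ k
  conn : ∀ Y : Set W, Y.Nonempty → Yᶜ.Nonempty → ∃ a ∈ Y, ∃ b ∈ Yᶜ, Γ.Adj a b
  deg : ∀ x, s ≤ (Finset.univ.filter (Γ.Adj x)).card

variable {c s k : ℕ} {v : ZMod c → W}

theorem PathBounded.indep (h : PathBounded Γ s k) (hv : IsLongestCycle Γ v) (hcs : 2 * s ≤ c)
    {u z : W} (hu : u ∉ Set.range v) (huz : Γ.Adj u z) : z ∈ Set.range v :=
  hv.outside_indep h.k_le h.four_le hcs h.path_le h.conn h.deg hu huz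

theorem PathBounded.card_indices [NeZero c] (h : PathBounded Γ s k) (hv : IsLongestCycle Γ v)
    (hcs : 2 * s ≤ c) (hcs' : c ≤ 2 * s + 1) {x : W} (hx : x ∉ Set.range v) :
    (Finset.univ.filter (fun i => Γ.Adj x (v i))).card = s := by
  have h1 := (hv.two_mul_card_le hx).1
  have h2 := card_nbrs_le_card_indices (Γ := Γ) (v := v) (x := x) ∅
    (fun z hz => Or.inr (h.indep hv hcs hx hz))
  have h3 := h.deg x
  simp only [Finset.card_empty] at h2
  omega

theorem PathBounded.gap_unique [NeZero c] (h : PathBounded Γ s k) (hv : IsLongestCycle Γ v)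
    (hcs : 2 * s ≤ c) (hcs' : c ≤ 2 * s + 1) {x : W} (hx : x ∉ Set.range v) {i j : ZMod c}
    (hi : ¬ Γ.Adj x (v i)) (hi' : ¬ Γ.Adj x (v (i - 1)))
    (hj : ¬ Γ.Adj x (v j)) (hj' : ¬ Γ.Adj x (v (j - 1))) : i = j ∧ c = 2 * s + 1 := by
  have h1 := (hv.two_mul_card_le hx).2
  rw [h.card_indices hv hcs hcs' hx] at h1
  set K := (Finset.univ.filter (fun i => Γ.Adj x (v i))) ∪
      (Finset.univ.filter (fun i => Γ.Adj x (v (i - 1)))) with hK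
  have h2 := Finset.card_compl K
  rw [h1, ZMod.card] at h2
  have hiK : i ∈ Kᶜ := by simp [hK, hi, hi']
  have hjK : j ∈ Kᶜ := by simp [hK, hj, hj']
  refine ⟨Finset.card_le_one.1 (by omega) i hiK j hjK, ?_⟩
  have := Finset.card_pos.2 ⟨i, hiK⟩
  omega

theorem PathBounded.not_adj_between (h : PathBounded Γ s k) (hv : IsLongestCycle Γ v)
    (hcs : 2 * s ≤ c) {x u : W} (hx : x ∉ Set.range v) (hu : u ∉ Set.range v) (hux : u ≠ x)
    {j : ZMod c} (h1 : Γ.Adj x (v (j - 1))) (h2 : Γ.Adj x (v (j + 1))) : ¬ Γ.Adj u (v j) := by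
  intro huj
  have h4 := h.four_le
  have hxj : v j ≠ x := fun hh => hx ⟨j, hh⟩
  exact notMem_range_update hv.1.1 hxj (Or.inr rfl)
    (h.indep (hv.update (by omega) hx h1 h2) hcs
      (notMem_range_update hv.1.1 hux (Or.inl hu)) huj)

theorem PathBounded.not_adj_gap (h : PathBounded Γ s k) (hv : IsLongestCycle Γ v)
    (hcs : 2 * s ≤ c) (hcs' : c ≤ 2 * s + 1) {x u : W} (hx : x ∉ Set.range v)
    (hu : u ∉ Set.range v) (hux : u ≠ x) {g : ZMod c} (hg : ¬ Γ.Adj x (v g))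
    (hg' : ¬ Γ.Adj x (v (g - 1))) : ¬ Γ.Adj u (v (g - 1)) := by
  intro hug
  have h4 := h.four_le
  have : NeZero c := ⟨by omega⟩
  have hc : 1 ≤ c := by omega
  have hne : ∀ m : ℕ, 0 < m → m < 8 → (m : ZMod c) ≠ 0 :=
    fun m h0 h1 => zmod_natCast_ne_zero h0 (by omega)
  have huniq : ∀ j, ¬ Γ.Adj x (v j) → ¬ Γ.Adj x (v (j - 1)) → j = g :=
    fun j hj hj' => (h.gap_unique hv hcs hcs' hx hj hj' hg hg').1
  have hg1 : Γ.Adj x (v (g + 1)) := by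
    by_contra hcon
    have := huniq (g + 1) hcon (by simpa using hg)
    exact hne 1 (by norm_num) (by norm_num) (by push_cast; linear_combination this)
  have hg2 : Γ.Adj x (v (g - 2)) := by
    by_contra hcon
    have := huniq (g - 1) hg' (by rwa [show g - 1 - 1 = g - 2 by ring])
    exact hne 1 (by norm_num) (by norm_num) (by push_cast; linear_combination -this)
  have hg3 : Γ.Adj x (v (g + 3)) := by
    by_contra hcon
    have h2 : ¬ Γ.Adj x (v (g + 2)) := by
      have := hv.not_adj_succ hc hx hg1
      rwa [show g + 1 + 1 = g + 2 by ring] at this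
    have := huniq (g + 3) hcon (by rwa [show g + 3 - 1 = g + 2 by ring])
    exact hne 3 (by norm_num) (by norm_num) (by push_cast; linear_combination this)
  have hug3 : Γ.Adj u (v (g + 3)) := by
    set I := Finset.univ.filter (fun i => Γ.Adj x (v i)) with hI
    set J := Finset.univ.filter (fun i => Γ.Adj u (v i)) with hJ
    have hIc : I.card = s := h.card_indices hv hcs hcs' hx
    have hJc : J.card = s := h.card_indices hv hcs hcs' hu
    have hsub : J ⊆ insert (g - 1) (I.erase (g - 2)) := by
      intro i hi
      have hi' : Γ.Adj u (v i) := by simpa [hJ] using hi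
      rw [Finset.mem_insert, Finset.mem_erase]
      by_cases hig : i = g - 1
      · exact Or.inl hig
      refine Or.inr ⟨?_, ?_⟩
      · rintro rfl
        refine hv.not_adj_succ hc hu hi' ?_
        rwa [show g - 2 + 1 = g - 1 by ring]
      · by_contra hiI
        have hiI' : ¬ Γ.Adj x (v i) := by simpa [hI] using hiI
        refine h.not_adj_between hv hcs hx hu hux ?_ ?_ hi'
        · by_contra hcon
          have := huniq i hiI' hcon
          subst this
          exact hv.not_adj_succ hc hu hug (by simpa using hi')
        · by_contra hcon
          have := huniq (i + 1) hcon (by simpa using hiI')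
          exact hig (by linear_combination this)
    have hg2I : g - 2 ∈ I := by simpa [hI] using hg2
    have hle : (insert (g - 1) (I.erase (g - 2))).card ≤ J.card := by
      have e1 := Finset.card_insert_le (g - 1) (I.erase (g - 2))
      rw [Finset.card_erase_of_mem hg2I] at e1
      omega
    have heq := Finset.eq_of_subset_of_card_le hsub hle
    have : g + 3 ∈ J := by
      rw [heq, Finset.mem_insert, Finset.mem_erase]
      refine Or.inr ⟨fun hh => ?_, by simpa [hI] using hg3⟩
      exact hne 5 (by norm_num) (by norm_num) (by push_cast; linear_combination hh)
    simpa [hJ] using this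
  have hadj1 : Γ.Adj (v (g + 1)) (v g) := (hv.1.2 g).symm
  have hadj2 : Γ.Adj (v g) (v (g - 1)) := by
    have := hv.1.2 (g - 1)
    rw [sub_add_cancel] at this
    exact this.symm
  obtain ⟨e, rfl⟩ : ∃ e, c = e + 5 := ⟨c - 5, by omega⟩
  have hcz : ((e : ℕ) : ZMod (e + 5)) + 5 = 0 := by
    have := ZMod.natCast_self (e + 5)
    push_cast at this
    exact this
  have hcyc : IsCycleList Γ
      ([v (g + 1), v g, v (g - 1), u] ++ (cycleArc v (g + 3) (e + 1) ++ [x])) := by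
    refine ⟨?_, ?_, ?_⟩
    · rw [List.nodup_append, List.nodup_append]
      have hinj : ∀ {a b : ZMod (e + 5)}, v a = v b ↔ a = b := hv.1.1.eq_iff
      refine ⟨?_, ⟨nodup_cycleArc hv.1.1 _ (by omega), by simp, ?_⟩, ?_⟩
      · have n1 : v (g + 1) ≠ v g := hadj1.ne
        have n2 : v g ≠ v (g - 1) := hadj2.ne
        have n3 : v (g + 1) ≠ v (g - 1) := by
          rw [Ne, hinj]
          intro hh
          exact hne 2 (by norm_num) (by norm_num) (by push_cast; linear_combination hh)
        have n4 : ∀ a, v a ≠ u := fun a ha => hu ⟨a, ha⟩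
        simp [n1, n2, n3, n4]
      · intro a ha b hb
        simp only [List.mem_singleton] at hb
        rintro rfl
        exact hx (hb ▸ mem_range_of_mem_cycleArc ha)
      · intro a ha b hb hab
        subst hab
        rcases List.mem_append.1 hb with hb | hb
        · obtain ⟨j, hj, rfl⟩ := mem_cycleArc.1 hb
          have hz : ∀ m : ℕ, 0 < m → m < 5 → ((j + m : ℕ) : ZMod (e + 5)) ≠ 0 :=
            fun m h0 h1 => zmod_natCast_ne_zero (by omega) (by omega)
          simp only [List.mem_cons, List.not_mem_nil, or_false, hinj] at ha
          rcases ha with ha | ha | ha | ha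
          · exact hz 2 (by norm_num) (by norm_num) (by push_cast; linear_combination ha)
          · exact hz 3 (by norm_num) (by norm_num) (by push_cast; linear_combination ha)
          · exact hz 4 (by norm_num) (by norm_num) (by push_cast; linear_combination ha)
          · exact hu ⟨_, ha⟩
        · simp only [List.mem_singleton] at hb
          subst hb
          simp only [List.mem_cons, List.not_mem_nil, or_false] at ha
          rcases ha with ha | ha | ha | ha
          · exact hx ⟨_, ha.symm⟩
          · exact hx ⟨_, ha.symm⟩
          · exact hx ⟨_, ha.symm⟩
          · exact hux ha.symm
    · rw [List.isChain_append, List.isChain_append]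
      refine ⟨?_, ⟨isChain_cycleArc hv.1.2 _ _, by simp, ?_⟩, ?_⟩
      · simp [hadj1, hadj2, hug.symm]
      · intro a ha b hb
        rw [getLast?_cycleArc, show g + 3 + (e : ZMod (e + 5)) = g - 2 by
          linear_combination hcz] at ha
        obtain rfl : v (g - 2) = a := by simpa using ha
        obtain rfl : x = b := by simpa using hb
        exact hg2.symm
      · intro a ha b hb
        obtain rfl : u = a := by simpa using ha
        rw [List.head?_append, head?_cycleArc _ _ (by omega)] at hb
        obtain rfl : v (g + 3) = b := by simpa using hb
        exact hug3
    · intro a ha b hb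
      obtain rfl : v (g + 1) = a := by simpa using ha
      obtain rfl : x = b := by
        simpa [List.getLast?_append, List.getLast?_cons] using hb
      exact hg1
  have := hv.2 _ hcyc
  simp [length_cycleArc] at this

theorem PathBounded.nbr_of_nbr (h : PathBounded Γ s k) (hv : IsLongestCycle Γ v)
    (hcs : 2 * s ≤ c) (hcs' : c ≤ 2 * s + 1) {x u z : W} (hx : x ∉ Set.range v)
    (hu : u ∉ Set.range v) (huz : Γ.Adj u z) : Γ.Adj x z := by
  obtain ⟨i, rfl⟩ := h.indep hv hcs hu huz
  by_contra hxi
  have hux : u ≠ x := by rintro rfl; exact hxi huz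
  by_cases h1 : Γ.Adj x (v (i - 1))
  · by_cases h2 : Γ.Adj x (v (i + 1))
    · exact h.not_adj_between hv hcs hx hu hux h1 h2 huz
    · exact h.not_adj_gap hv hcs hcs' hx hu hux (g := i + 1) h2 (by simpa using hxi)
        (by simpa using huz)
  · have hrange : ∀ y, y ∉ Set.range v → y ∉ Set.range (fun i => v (-i)) := by
      rintro y hy ⟨j, hj⟩
      exact hy ⟨-j, hj⟩
    refine h.not_adj_gap hv.comp_neg hcs hcs' (hrange x hx) (hrange u hu) hux (g := 1 - i) ?_ ?_ ?_
    · rwa [show -(1 - i) = i - 1 by ring]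
    · rwa [show -(1 - i - 1) = i by ring]
    · rwa [show -(1 - i - 1) = i by ring]

/-- If a longest cycle has at least `2 s` vertices then, up to two exceptional vertices, all
edges meet a fixed set of `s` vertices. -/
theorem PathBounded.exists_core (h : PathBounded Γ s k) (hv : IsLongestCycle Γ v)
    (hcs : 2 * s ≤ c) (hcs' : c ≤ 2 * s + 1) (hcard : c + 2 ≤ Fintype.card W) :
    ∃ A : Finset W, A.card = s ∧ ((∀ u ∉ A, ∀ z, Γ.Adj u z → z ∈ A) ∨
      (c = 2 * s + 1 ∧ ∃ b1 ∉ A, ∃ b2 ∉ A, b1 ≠ b2 ∧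
        ∀ u ∉ A, u ≠ b1 → u ≠ b2 → ∀ z, Γ.Adj u z → z ∈ A)) := by
  have h4 := h.four_le
  have : NeZero c := ⟨by omega⟩
  have hCc : (Finset.univ.image v).card = c := by
    rw [Finset.card_image_of_injective _ hv.1.1, Finset.card_univ, ZMod.card]
  obtain ⟨x, y, hxy, hx, hy⟩ : ∃ x y, x ≠ y ∧ x ∉ Set.range v ∧ y ∉ Set.range v := by
    have hco : 1 < ((Finset.univ.image v)ᶜ).card := by
      rw [Finset.card_compl, hCc]; omega
    obtain ⟨x, hx, y, hy, hxy⟩ := Finset.one_lt_card.1 hco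
    exact ⟨x, y, hxy, by simpa using hx, by simpa using hy⟩
  have hmem : ∀ z, z ∈ Finset.univ.filter (Γ.Adj x) ↔ Γ.Adj x z := by simp
  have hbetween : ∀ i, ¬ Γ.Adj x (v i) → Γ.Adj x (v (i - 1)) → Γ.Adj x (v (i + 1)) →
      ∀ z, Γ.Adj (v i) z → Γ.Adj x z := by
    intro i hi h1 h2 z hz
    have hiy : v i ≠ x := fun hh => hx ⟨i, hh⟩
    have hv' := hv.update (by omega) hx h1 h2
    exact h.nbr_of_nbr hv hcs hcs' hx hy (h.nbr_of_nbr hv' hcs hcs'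
      (notMem_range_update hv.1.1 hxy.symm (Or.inl hy))
      (notMem_range_update hv.1.1 hiy (Or.inr rfl)) hz)
  refine ⟨Finset.univ.filter (Γ.Adj x), ?_, ?_⟩
  · have h1 := h.deg x
    have h2 := card_nbrs_le_card_indices (Γ := Γ) (v := v) (x := x) ∅
      (fun z hz => Or.inr (h.indep hv hcs hx hz))
    rw [h.card_indices hv hcs hcs' hx, Finset.card_empty] at h2
    omega
  simp only [hmem]
  by_cases hgap : ∃ g, ¬ Γ.Adj x (v g) ∧ ¬ Γ.Adj x (v (g - 1))
  · obtain ⟨g, hg, hg'⟩ := hgap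
    have huniq : ∀ j, ¬ Γ.Adj x (v j) → ¬ Γ.Adj x (v (j - 1)) → j = g :=
      fun j hj hj' => (h.gap_unique hv hcs hcs' hx hj hj' hg hg').1
    refine Or.inr ⟨(h.gap_unique hv hcs hcs' hx hg hg' hg hg').2, v g, hg, v (g - 1), hg', ?_, ?_⟩
    · have := hv.1.2 (g - 1)
      rw [sub_add_cancel] at this
      exact this.ne'
    · intro u hu hu1 hu2 z hz
      by_cases hur : u ∈ Set.range v
      · obtain ⟨i, rfl⟩ := hur
        refine hbetween i hu ?_ ?_ z hz
        · by_contra hcon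
          exact hu1 (by rw [huniq i hu hcon])
        · by_contra hcon
          apply hu2
          rw [← huniq (i + 1) hcon (by simpa using hu)]
          simp
      · exact h.nbr_of_nbr hv hcs hcs' hx hur hz
  · push Not at hgap
    left
    intro u hu z hz
    by_cases hur : u ∈ Set.range v
    · obtain ⟨i, rfl⟩ := hur
      refine hbetween i hu (hgap i hu) ?_ z hz
      by_contra hcon
      have := hgap (i + 1) hcon
      exact hu (by simpa using this)
    · exact h.nbr_of_nbr hv hcs hcs' hx hur hz

theorem exists_longestCycle (hs : 1 ≤ s) (hne : Nonempty W)
    (hk : ∀ l : List W, l.Nodup → l.IsChain Γ.Adj → l.length ≤ k)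
    (hdeg : ∀ x, s ≤ (Finset.univ.filter (Γ.Adj x)).card) :
    ∃ c, s + 1 ≤ c ∧ ∃ v : ZMod c → W, IsLongestCycle Γ v := by
  let P : ℕ → Prop := fun m => ∃ l : List W, l.Nodup ∧ l.IsChain Γ.Adj ∧ l.length = m
  obtain ⟨x0⟩ := hne
  have hP : P 1 := ⟨[x0], by simp, by simp, rfl⟩
  have hPb : ∀ m, P m → m ≤ k := by rintro m ⟨l, h1, h2, rfl⟩; exact hk l h1 h2
  obtain ⟨l, hl1, hl2, hl3⟩ := Nat.findGreatest_spec (P := P) (hPb 1 hP) hP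
  have hlmax : ∀ l' : List W, l'.Nodup → l'.IsChain Γ.Adj → l'.length ≤ l.length := by
    intro l' h1 h2
    rw [hl3]
    exact Nat.le_findGreatest (hk l' h1 h2) ⟨l', h1, h2, rfl⟩
  have hlne : l ≠ [] := by
    rintro rfl
    have := hlmax [x0] (by simp) (by simp)
    simp at this
  obtain ⟨l0, x, rfl⟩ : ∃ l0 x, l = l0 ++ [x] := ⟨_, _, (List.dropLast_append_getLast hlne).symm⟩
  obtain ⟨l1, hl1c, hl1s⟩ := exists_cycleList_of_path (Γ := Γ) hl1 hl2
    (Finset.univ.filter (Γ.Adj x)) (by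
      intro z hz
      have hz' := (Finset.mem_filter.1 hz).2
      refine ⟨?_, hz'⟩
      by_contra hzl
      have := hlmax ((l0 ++ [x]) ++ [z]) ?_ ?_
      · simp at this
      · rw [List.nodup_append]
        refine ⟨hl1, by simp, ?_⟩
        intro a ha b hb hab
        simp only [List.mem_singleton] at hb
        subst hab; subst hb
        simp [hzl, hz'.ne'] at ha
      · rw [List.isChain_append]
        refine ⟨hl2, by simp, ?_⟩
        intro a ha b hb
        obtain rfl : x = a := by simpa using ha
        obtain rfl : z = b := by simpa using hb
        exact hz') (Finset.card_pos.1 (by have := hdeg x; omega))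
  let Q : ℕ → Prop := fun m => ∃ l : List W, IsCycleList Γ l ∧ l.length = m
  have hQb : ∀ m, Q m → m ≤ k := by rintro m ⟨l, h1, rfl⟩; exact hk l h1.1 h1.2.1
  have hQ1 : Q l1.length := ⟨l1, hl1c, rfl⟩
  obtain ⟨l2, hl2c, hl2l⟩ := Nat.findGreatest_spec (P := Q) (hQb _ hQ1) hQ1
  have hmax : ∀ l', IsCycleList Γ l' → l'.length ≤ l2.length := by
    intro l' h1
    rw [hl2l]
    exact Nat.le_findGreatest (hQb _ ⟨l', h1, rfl⟩) ⟨l', h1, rfl⟩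
  have hlen : s + 1 ≤ l2.length := by
    have := hmax l1 hl1c
    have := hdeg x
    omega
  obtain ⟨v, hv⟩ := hl2c.exists_cycleMap (by rintro rfl; simp at hlen)
  exact ⟨l2.length, hlen, v, hv, hmax⟩

theorem PathBounded.trichotomy {D : ℕ} (h : PathBounded Γ s k) (hcard : k + 2 ≤ Fintype.card W)
    (w : Finset W → ℕ)
    (hw : ∀ U : Finset W, ∀ x ∈ U, (U.filter (Γ.Adj x)).card ≤ s → w U ≤ w (U.erase x) + D)
    (hw' : ∀ U : Finset W, ∀ x ∈ U, (U.filter (Γ.Adj x)).card ≤ s - 1 →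
      w U + 1 ≤ w (U.erase x) + D) :
    (k = 2 * s + 2 ∧ ∃ C : Finset W, C.card = s + 1 ∧
      w Finset.univ ≤ w C + D * (Fintype.card W - (s + 1))) ∨
    (∃ C : Finset W, (k = 2 * s + 1 ∧ C.card = s + 1 ∨ k = 2 * s + 2 ∧ C.card = s + 2) ∧
      w Finset.univ + 1 ≤ w C + D * (Fintype.card W - C.card)) ∨
    (∃ A : Finset W, A.card = s ∧ ((∀ u ∉ A, ∀ z, Γ.Adj u z → z ∈ A) ∨
      (k = 2 * s + 2 ∧ ∃ b1 ∉ A, ∃ b2 ∉ A, b1 ≠ b2 ∧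
        ∀ u ∉ A, u ≠ b1 → u ≠ b2 → ∀ z, Γ.Adj u z → z ∈ A))) := by
  have h4 := h.four_le
  have hk1 := h.le_k
  have hk2 := h.k_le
  obtain ⟨c, hcs, v, hv⟩ := exists_longestCycle (Γ := Γ) (s := s) (k := k) (by omega)
    (Fintype.card_pos_iff.1 (by omega)) h.path_le h.deg
  have : NeZero c := ⟨by omega⟩
  have hCc : (Finset.univ.image v).card = c := by
    rw [Finset.card_image_of_injective _ hv.1.1, Finset.card_univ, ZMod.card]
  have hck : c ≤ k := by
    have := h.path_le _ (nodup_cycleArc hv.1.1 0 le_rfl) (isChain_cycleArc hv.1.2 0 c)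
    rwa [length_cycleArc] at this
  have hC : ∀ x, x ∈ Finset.univ.image v ↔ x ∈ Set.range v := by simp
  obtain ⟨u, hu⟩ : ∃ u, u ∉ Set.range v := by
    by_contra hcon
    push Not at hcon
    have := Finset.card_le_card (show Finset.univ ⊆ Finset.univ.image v from
      fun x _ => (hC x).2 (hcon x))
    rw [Finset.card_univ, hCc] at this
    omega
  obtain ⟨p, R, x, -, hR, hmax⟩ := exists_longest_outward (by omega) hv.1 h.path_le h.conn
    (Finset.mem_univ u) hu
  have hlen := hR.length_add_le (by omega) hv.1 h.path_le
  have hRpos : 0 < R.length := List.length_pos_iff.2 (by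
    rintro rfl; simpa using hR.mem)
  by_cases hc2 : c < 2 * s
  · have hM : ∀ z ∈ Finset.univ.filter (Γ.Adj x), Γ.Adj x z ∧ (z ∈ R ∨ z ∈ Set.range v) := by
      intro z hz
      rw [Finset.mem_filter] at hz
      exact ⟨hz.2, nbr_mem_of_longest_outward hR hmax hz.1 hz.2⟩
    have hdx := h.deg x
    have hq : s ≤ R.length := by
      rcases hv.outward_nbrs (by omega) hR _ hM with hh | hh
      · have := hv.card_le_of_outward hR _ (Finset.card_pos.1 (by omega))
          (fun z hz => ⟨(hM z hz).1, hh z hz⟩)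
        omega
      · omega
    by_cases hmid : c + s + 1 ≤ k
    · left
      refine ⟨by omega, Finset.univ.image v, by omega, ?_⟩
      refine hv.weight_le (by omega) hk2 (by omega) h.path_le h.conn w hw _ hC _ _
        (Finset.subset_univ _) ?_
      rw [Finset.card_univ]
      omega
    · right; left
      refine ⟨Finset.univ.image v, by omega, ?_⟩
      exact hv.weight_lt hk2 (by omega) h4 hcs hc2 (by omega) h.path_le h.conn h.deg w hw hw' _ hC
        _ (by omega) (by omega)
  · right; right
    obtain ⟨A, hA, hA'⟩ := h.exists_core hv (by omega) (by omega) (by omega)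
    refine ⟨A, hA, hA'.imp_right ?_⟩
    rintro ⟨h1, h2⟩
    exact ⟨by omega, h2⟩

end Structure

section Decomposition

variable {V : Type*}

/-- A system of red pairs `red` and blue pairs `blue` with distinct representing hyperedges,
together with a set `rest` of hyperedges all of whose pairs are blue, such that the red pairs and
the hyperedges of `rest` together account for all hyperedges of `H`. -/
structure PairSystem (H : Finset (Finset V)) where
  red : Finset (Finset V)
  blue : Finset (Finset V)
  rest : Finset (Finset V)
  rep : Finset V → Finset V
  disj : Disjoint red blue
  card_red : ∀ p ∈ red, p.card = 2
  card_blue : ∀ p ∈ blue, p.card = 2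
  rest_sub : rest ⊆ H
  card_eq : H.card = red.card + rest.card
  pair_blue : ∀ e ∈ rest, ∀ p ⊆ e, p.card = 2 → p ∈ blue
  rep_inj : ∀ p ∈ red ∪ blue, ∀ q ∈ red ∪ blue, rep p = rep q → p = q
  rep_mem : ∀ p ∈ red ∪ blue, rep p ∈ H
  sub_rep : ∀ p ∈ red ∪ blue, p ⊆ rep p

theorem exists_pairSystem (H : Finset (Finset V)) : Nonempty (PairSystem H) := by
  let N : Finset (Finset V) → Finset (Finset V) := fun E => E.biUnion (Finset.powersetCard 2)
  have hN : ∀ E p, p ∈ N E ↔ ∃ e ∈ E, p ⊆ e ∧ p.card = 2 := by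
    intro E p
    simp [N, Finset.mem_biUnion, Finset.mem_powersetCard]
  obtain ⟨E, hEH, hE⟩ := Finset.exists_max_image H.powerset
    (fun E => (E.card : ℤ) - (N E).card) ⟨∅, by simp⟩
  rw [Finset.mem_powerset] at hEH
  have hEmax : ∀ F ⊆ H, (F.card : ℤ) - (N F).card ≤ (E.card : ℤ) - (N E).card :=
    fun F hF => hE F (Finset.mem_powerset.2 hF)
  obtain ⟨μ, hμi, hμ⟩ := (Finset.all_card_le_biUnion_card_iff_exists_injective
    (fun e : {e // e ∈ H \ E} => Finset.powersetCard 2 e.1 \ N E)).1 (by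
      intro F
      have hFm : ∀ e ∈ F.map (Function.Embedding.subtype _), e ∈ H \ E := by
        intro e he
        obtain ⟨e', -, rfl⟩ := Finset.mem_map.1 he
        exact e'.2
      have hdis : Disjoint E (F.map (Function.Embedding.subtype _)) := by
        rw [Finset.disjoint_left]
        intro e he he'
        exact (Finset.mem_sdiff.1 (hFm e he')).2 he
      have h1 := hEmax (E ∪ F.map (Function.Embedding.subtype _)) (Finset.union_subset hEH
        (fun e he => (Finset.mem_sdiff.1 (hFm e he)).1))
      rw [Finset.card_union_of_disjoint hdis, Finset.card_map] at h1
      have h2 : N (E ∪ F.map (Function.Embedding.subtype _)) ⊆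
          N E ∪ F.biUnion (fun e => Finset.powersetCard 2 e.1 \ N E) := by
        intro p hp
        by_cases hpE : p ∈ N E
        · exact Finset.mem_union_left _ hpE
        · obtain ⟨e, he, hpe⟩ := (hN _ _).1 hp
          rcases Finset.mem_union.1 he with he | he
          · exact absurd ((hN _ _).2 ⟨e, he, hpe⟩) hpE
          · obtain ⟨e', he', rfl⟩ := Finset.mem_map.1 he
            refine Finset.mem_union_right _ (Finset.mem_biUnion.2 ⟨e', he', ?_⟩)
            exact Finset.mem_sdiff.2 ⟨Finset.mem_powersetCard.2 hpe, hpE⟩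
      have h3 := (Finset.card_le_card h2).trans (Finset.card_union_le _ _)
      push_cast at h1
      omega)
  obtain ⟨f, hfi, hf⟩ := (Finset.all_card_le_biUnion_card_iff_exists_injective
    (fun p : {p // p ∈ N E} => E.filter (fun e => p.1 ⊆ e))).1 (by
      intro P
      set T := P.biUnion (fun p => E.filter (fun e => p.1 ⊆ e)) with hT
      have hTE : T ⊆ E := by
        intro e he
        obtain ⟨p, -, hp⟩ := Finset.mem_biUnion.1 he
        exact (Finset.mem_filter.1 hp).1
      have h1 := hEmax (E \ T) (Finset.sdiff_subset.trans hEH)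
      have hPm : P.map (Function.Embedding.subtype _) ⊆ N E := by
        intro p hp
        obtain ⟨p', -, rfl⟩ := Finset.mem_map.1 hp
        exact p'.2
      have h2 : N (E \ T) ⊆ N E \ P.map (Function.Embedding.subtype _) := by
        intro p hp
        obtain ⟨e, he, hpe⟩ := (hN _ _).1 hp
        rw [Finset.mem_sdiff] at he
        refine Finset.mem_sdiff.2 ⟨(hN _ _).2 ⟨e, he.1, hpe⟩, ?_⟩
        intro hpP
        obtain ⟨p', hp', rfl⟩ := Finset.mem_map.1 hpP
        exact he.2 (Finset.mem_biUnion.2 ⟨p', hp', Finset.mem_filter.2 ⟨he.1, hpe.1⟩⟩)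
      have h3 := Finset.card_le_card h2
      rw [Finset.card_sdiff_of_subset hPm, Finset.card_map] at h3
      have h4 := Finset.card_le_card hPm
      rw [Finset.card_map] at h4
      rw [Finset.card_sdiff_of_subset hTE] at h1
      have h5 := Finset.card_le_card hTE
      omega)
  let rep : Finset V → Finset V := fun p =>
    if h : p ∈ N E then f ⟨p, h⟩ else if h : ∃ e, μ e = p then h.choose.1 else ∅
  have hrepB : ∀ p (h : p ∈ N E), rep p = f ⟨p, h⟩ := fun p h => by simp [rep, h]
  have hμN : ∀ e, μ e ∉ N E := fun e => (Finset.mem_sdiff.1 (hμ e)).2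
  have hrepR : ∀ e, rep (μ e) = e.1 := by
    intro e
    have hex : ∃ e', μ e' = μ e := ⟨e, rfl⟩
    have : rep (μ e) = hex.choose.1 := by
      simp only [rep, hμN e, dite_false]
      rw [dif_pos hex]
    rw [this, hμi hex.choose_spec]
  have hfE : ∀ p, f p ∈ E ∧ p.1 ⊆ f p := fun p => Finset.mem_filter.1 (hf p)
  have hcases : ∀ p ∈ Finset.univ.image μ ∪ N E, (∃ e, μ e = p) ∨ p ∈ N E := by
    intro p hp
    rcases Finset.mem_union.1 hp with hp | hp
    · left; simpa using hp
    · right; exact hp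
  refine ⟨⟨Finset.univ.image μ, N E, E, rep, ?_, ?_, ?_, hEH, ?_, ?_, ?_, ?_, ?_⟩⟩
  · rw [Finset.disjoint_left]
    intro p hp
    obtain ⟨e, -, rfl⟩ := Finset.mem_image.1 hp
    exact hμN e
  · intro p hp
    obtain ⟨e, -, rfl⟩ := Finset.mem_image.1 hp
    exact (Finset.mem_powersetCard.1 (Finset.mem_sdiff.1 (hμ e)).1).2
  · intro p hp
    obtain ⟨e, -, hpe⟩ := (hN _ _).1 hp
    exact hpe.2
  · rw [Finset.card_image_of_injective _ hμi, Finset.card_univ, Fintype.card_coe,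
      Finset.card_sdiff_of_subset hEH]
    have := Finset.card_le_card hEH
    omega
  · intro e he p hpe hp
    exact (hN _ _).2 ⟨e, he, hpe, hp⟩
  · intro p hp q hq hpq
    rcases hcases p hp with ⟨e, rfl⟩ | hp <;> rcases hcases q hq with ⟨e', rfl⟩ | hq
    · rw [hrepR, hrepR] at hpq
      rw [Subtype.ext hpq]
    · rw [hrepR, hrepB q hq] at hpq
      exact absurd (hpq ▸ (hfE ⟨q, hq⟩).1) (Finset.mem_sdiff.1 e.2).2
    · rw [hrepR, hrepB p hp] at hpq
      exact absurd (hpq ▸ (hfE ⟨p, hp⟩).1) (Finset.mem_sdiff.1 e'.2).2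
    · rw [hrepB p hp, hrepB q hq] at hpq
      simpa using hfi hpq
  · intro p hp
    rcases hcases p hp with ⟨e, rfl⟩ | hp
    · rw [hrepR]; exact (Finset.mem_sdiff.1 e.2).1
    · rw [hrepB p hp]; exact hEH (hfE ⟨p, hp⟩).1
  · intro p hp
    rcases hcases p hp with ⟨e, rfl⟩ | hp
    · rw [hrepR]
      exact (Finset.mem_powersetCard.1 (Finset.mem_sdiff.1 (hμ e)).1).1
    · rw [hrepB p hp]; exact (hfE ⟨p, hp⟩).2

end Decomposition

section Weight

variable {V : Type*} {H : Finset (Finset V)}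

/-- The graph of all red and blue pairs. -/
def PairSystem.graph (P : PairSystem H) : SimpleGraph V where
  Adj u v := u ≠ v ∧ ({u, v} : Finset V) ∈ P.red ∪ P.blue
  symm := ⟨fun u v h => ⟨h.1.symm, by rw [Finset.pair_comm]; exact h.2⟩⟩
  loopless := ⟨fun _ h => h.1 rfl⟩

/-- The number of red pairs and remaining hyperedges inside `U`. -/
noncomputable def PairSystem.weight (P : PairSystem H) (U : Finset V) : ℕ :=
  (P.red.filter (· ⊆ U)).card + (P.rest.filter (· ⊆ U)).card

theorem PairSystem.weight_mono (P : PairSystem H) {U U' : Finset V} (h : U ⊆ U') :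
    P.weight U ≤ P.weight U' := by
  refine Nat.add_le_add (Finset.card_le_card ?_) (Finset.card_le_card ?_) <;>
  · intro e he
    rw [Finset.mem_filter] at he ⊢
    exact ⟨he.1, he.2.trans h⟩

theorem PairSystem.weight_univ [Fintype V] (P : PairSystem H) :
    P.weight Finset.univ = H.card := by
  simp [PairSystem.weight, P.card_eq]

theorem add_choose_le_choose {r a b d : ℕ} (hr : 3 ≤ r) (hrd : r ≤ d) (hab : a + b ≤ d) :
    a + b.choose (r - 1) ≤ d.choose (r - 1) := by
  induction d, hrd using Nat.le_induction generalizing a b with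
  | base =>
    have hc : r.choose (r - 1) = r := by
      rw [Nat.choose_symm_of_eq_add (show r = (r - 1) + 1 by omega), Nat.choose_one_right]
    rw [hc]
    rcases lt_trichotomy b (r - 1) with h | h | h
    · rw [Nat.choose_eq_zero_of_lt h]; omega
    · rw [h, Nat.choose_self]; omega
    · have : b = r := by omega
      rw [this, hc]; omega
  | succ d hd ih =>
    have h1 : (d + 1).choose (r - 1) = d.choose (r - 2) + d.choose (r - 1) := by
      rw [show r - 1 = (r - 2) + 1 by omega, Nat.choose_succ_succ]
    have h2 : 0 < d.choose (r - 2) := Nat.choose_pos (by omega)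
    by_cases hb : b = d + 1
    · have : a = 0 := by omega
      simp [this, hb]
    · rcases Nat.eq_zero_or_pos a with rfl | ha
      · have := ih (a := 0) (b := b) (by omega)
        omega
      · have := ih (a := a - 1) (b := b) (by omega)
        omega

theorem PairSystem.weight_le_erase (P : PairSystem H) {r d : ℕ} (hr : 3 ≤ r) (hrd : r ≤ d)
    (huni : ∀ e ∈ H, e.card = r) {U : Finset V} {x : V}
    (hdeg : (U.filter (P.graph.Adj x)).card ≤ d) :
    P.weight U ≤ P.weight (U.erase x) + d.choose (r - 1) := by
  set Rn := (U.erase x).filter (fun u => ({x, u} : Finset V) ∈ P.red) with hRn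
  set Bn := (U.erase x).filter (fun u => ({x, u} : Finset V) ∈ P.blue) with hBn
  have hdis : Disjoint Rn Bn := by
    rw [Finset.disjoint_left]
    intro u hu hu'
    exact Finset.disjoint_left.1 P.disj (Finset.mem_filter.1 hu).2 (Finset.mem_filter.1 hu').2
  have hle : Rn.card + Bn.card ≤ d := by
    rw [← Finset.card_union_of_disjoint hdis]
    refine (Finset.card_le_card ?_).trans hdeg
    intro u hu
    rcases Finset.mem_union.1 hu with hu | hu <;>
    · rw [Finset.mem_filter, Finset.mem_erase] at hu
      refine Finset.mem_filter.2 ⟨hu.1.2, hu.1.1.symm, ?_⟩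
      rw [Finset.mem_union]
      tauto
  have hred : (P.red.filter (· ⊆ U)) ⊆
      P.red.filter (· ⊆ U.erase x) ∪ Rn.image (fun u => {x, u}) := by
    intro p hp
    rw [Finset.mem_filter] at hp
    by_cases hxp : x ∈ p
    · apply Finset.mem_union_right
      obtain ⟨u, hu⟩ : ∃ u, p.erase x = {u} := by
        rw [← Finset.card_eq_one, Finset.card_erase_of_mem hxp, P.card_red p hp.1]
      have hpx : p = {x, u} := by rw [← Finset.insert_erase hxp, hu]
      have hup : u ∈ p.erase x := by rw [hu]; simp
      rw [Finset.mem_erase] at hup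
      refine Finset.mem_image.2 ⟨u, ?_, hpx.symm⟩
      exact Finset.mem_filter.2 ⟨Finset.mem_erase.2 ⟨hup.1, hp.2 hup.2⟩, hpx ▸ hp.1⟩
    · exact Finset.mem_union_left _ (Finset.mem_filter.2
        ⟨hp.1, fun y hy => Finset.mem_erase.2 ⟨fun h => hxp (h ▸ hy), hp.2 hy⟩⟩)
  have hrest : (P.rest.filter (· ⊆ U)) ⊆
      P.rest.filter (· ⊆ U.erase x) ∪ (Finset.powersetCard (r - 1) Bn).image (insert x) := by
    intro e he
    rw [Finset.mem_filter] at he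
    by_cases hxe : x ∈ e
    · apply Finset.mem_union_right
      refine Finset.mem_image.2 ⟨e.erase x, ?_, Finset.insert_erase hxe⟩
      rw [Finset.mem_powersetCard, Finset.card_erase_of_mem hxe, huni e (P.rest_sub he.1)]
      refine ⟨?_, rfl⟩
      intro u hu
      have hu' := Finset.mem_erase.1 hu
      refine Finset.mem_filter.2 ⟨Finset.mem_erase.2 ⟨hu'.1, he.2 hu'.2⟩, ?_⟩
      refine P.pair_blue e he.1 _ ?_ (Finset.card_pair hu'.1.symm)
      intro y hy
      simp only [Finset.mem_insert, Finset.mem_singleton] at hy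
      rcases hy with rfl | rfl
      · exact hxe
      · exact hu'.2
    · exact Finset.mem_union_left _ (Finset.mem_filter.2
        ⟨he.1, fun y hy => Finset.mem_erase.2 ⟨fun h => hxe (h ▸ hy), he.2 hy⟩⟩)
  have h1 := (Finset.card_le_card hred).trans (Finset.card_union_le _ _)
  have h2 := (Finset.card_le_card hrest).trans (Finset.card_union_le _ _)
  have h3 := Finset.card_image_le (s := Rn) (f := fun u => ({x, u} : Finset V))
  have h4 := Finset.card_image_le (s := Finset.powersetCard (r - 1) Bn) (f := insert x)
  rw [Finset.card_powersetCard] at h4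
  have h5 := add_choose_le_choose hr hrd hle
  unfold PairSystem.weight
  omega

theorem PairSystem.weight_lt_erase (P : PairSystem H) {r s : ℕ} (hr : 3 ≤ r) (hrs : r + 1 ≤ s)
    (huni : ∀ e ∈ H, e.card = r) {U : Finset V} {x : V}
    (hdeg : (U.filter (P.graph.Adj x)).card ≤ s - 1) :
    P.weight U + 1 ≤ P.weight (U.erase x) + s.choose (r - 1) := by
  have h1 := P.weight_le_erase hr (by omega) huni hdeg
  have h2 := add_choose_le_choose (a := 1) (b := s - 1) (d := s) hr (by omega) (by omega)
  omega

/-- Comparison of the weight of `U` with the size of a family of `r`-sets which contains the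
remaining hyperedges and many sets above every red pair. -/
theorem PairSystem.weight_le_card (P : PairSystem H) {r : ℕ} (hr : 3 ≤ r) {U : Finset V}
    {F : Finset (Finset V)} (hF : ∀ e ∈ F, e.card = r)
    (hrest : P.rest.filter (· ⊆ U) ⊆ F)
    (hred : ∀ p ∈ P.red, p ⊆ U → ∃ Z, Disjoint p Z ∧ r + 1 ≤ Z.card ∧
      ∀ Y ∈ Finset.powersetCard (r - 2) Z, p ∪ Y ∈ F) :
    P.weight U ≤ F.card ∧
      (F.card ≤ P.weight U → P.red.filter (· ⊆ U) = ∅ ∧ P.rest.filter (· ⊆ U) = F) := by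
  have hle := Finset.card_le_card hrest
  by_cases hempty : P.red.filter (· ⊆ U) = ∅
  · unfold PairSystem.weight
    rw [hempty, Finset.card_empty, zero_add]
    exact ⟨hle, fun h => ⟨rfl, Finset.eq_of_subset_of_card_le hrest h⟩⟩
  have hpos : 0 < (P.red.filter (· ⊆ U)).card :=
    Finset.card_pos.2 (Finset.nonempty_iff_ne_empty.2 hempty)
  set F' := F \ P.rest.filter (· ⊆ U) with hF'
  have hF'c : F'.card = F.card - (P.rest.filter (· ⊆ U)).card :=
    Finset.card_sdiff_of_subset hrest
  have hdouble : (P.red.filter (· ⊆ U)).card * (r + 1).choose (r - 2) ≤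
      F'.card * r.choose 2 := by
    refine Finset.card_mul_le_card_mul (fun p f : Finset V => p ⊆ f) ?_ ?_
    · intro p hp
      rw [Finset.mem_filter] at hp
      obtain ⟨Z, hpZ, hZ, hY⟩ := hred p hp.1 hp.2
      have hsub : (Finset.powersetCard (r - 2) Z).image (p ∪ ·) ⊆
          Finset.bipartiteAbove (fun p f : Finset V => p ⊆ f) F' p := by
        intro e he
        obtain ⟨Y, hYZ, rfl⟩ := Finset.mem_image.1 he
        rw [Finset.mem_bipartiteAbove]
        refine ⟨Finset.mem_sdiff.2 ⟨hY Y hYZ, fun hh => ?_⟩, Finset.subset_union_left⟩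
        exact Finset.disjoint_left.1 P.disj hp.1 (P.pair_blue _ (Finset.mem_filter.1 hh).1 p
          Finset.subset_union_left (P.card_red p hp.1))
      refine le_trans ?_ (Finset.card_le_card hsub)
      rw [Finset.card_image_of_injOn, Finset.card_powersetCard]
      · exact Nat.choose_le_choose _ hZ
      · intro Y1 hY1 Y2 hY2 heq
        have hd : ∀ Y, Y ∈ (Finset.powersetCard (r - 2) Z : Set (Finset V)) → (p ∪ Y) \ p = Y := by
          intro Y hY
          rw [Finset.union_sdiff_cancel_left]
          exact Finset.disjoint_of_subset_right
            (Finset.mem_powersetCard.1 (Finset.mem_coe.1 hY)).1 hpZ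
        have heq' : p ∪ Y1 = p ∪ Y2 := heq
        rw [← hd Y1 hY1, ← hd Y2 hY2, heq']
    · intro f hf
      have hfc : f.card = r := hF f (Finset.mem_sdiff.1 hf).1
      rw [← hfc, ← Finset.card_powersetCard]
      apply Finset.card_le_card
      intro p hp
      rw [Finset.mem_bipartiteBelow, Finset.mem_filter] at hp
      exact Finset.mem_powersetCard.2 ⟨hp.2, P.card_red p hp.1.1⟩
  have hch : r.choose 2 < (r + 1).choose (r - 2) := by
    have h1 : (r + 1).choose (r - 2) = r.choose (r - 3) + r.choose (r - 2) := by
      rw [show r - 2 = (r - 3) + 1 by omega, Nat.choose_succ_succ]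
    have h2 : r.choose (r - 2) = r.choose 2 :=
      Nat.choose_symm_of_eq_add (by omega)
    have h3 : 0 < r.choose (r - 3) := Nat.choose_pos (by omega)
    omega
  have hlt : (P.red.filter (· ⊆ U)).card < F'.card := by
    by_contra hcon
    push Not at hcon
    have h1 := Nat.mul_le_mul_right (r.choose 2) hcon
    have h2 := Nat.mul_lt_mul_of_pos_left hch hpos
    omega
  unfold PairSystem.weight
  refine ⟨by omega, fun h => ?_⟩
  omega

theorem PairSystem.weight_le_choose (P : PairSystem H) {r : ℕ} (hr : 3 ≤ r)
    (huni : ∀ e ∈ H, e.card = r) {U : Finset V} (hU : r + 3 ≤ U.card) :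
    P.weight U ≤ U.card.choose r := by
  rw [← Finset.card_powersetCard]
  refine (P.weight_le_card hr (fun e he => (Finset.mem_powersetCard.1 he).2) ?_ ?_).1
  · intro e he
    rw [Finset.mem_filter] at he
    exact Finset.mem_powersetCard.2 ⟨he.2, huni e (P.rest_sub he.1)⟩
  · intro p hp hpU
    have hp2 := P.card_red p hp
    refine ⟨U \ p, Finset.disjoint_sdiff, ?_, ?_⟩
    · rw [Finset.card_sdiff_of_subset hpU]; omega
    · intro Y hY
      rw [Finset.mem_powersetCard] at hY ⊢
      refine ⟨Finset.union_subset hpU (hY.1.trans Finset.sdiff_subset), ?_⟩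
      rw [Finset.card_union_of_disjoint
        (Finset.disjoint_of_subset_right hY.1 Finset.disjoint_sdiff), hY.2, hp2]
      omega

theorem PairSystem.weight_le_of_degenerate (P : PairSystem H) {r s : ℕ} (hr : 3 ≤ r)
    (hrs : r + 3 ≤ s) (huni : ∀ e ∈ H, e.card = r) {T : Finset V}
    (hdeg : ∀ U ⊆ T, U.Nonempty → ∃ x ∈ U, (U.filter (P.graph.Adj x)).card ≤ s) (m : ℕ)
    (hT : T.card = s + m) : P.weight T ≤ s.choose (r - 1) * m + s.choose r := by
  induction m generalizing T with
  | zero =>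
    have := P.weight_le_choose hr huni (U := T) (by omega)
    rw [hT] at this
    simpa using this
  | succ m ih =>
    obtain ⟨x, hx, hxd⟩ := hdeg T le_rfl (Finset.card_pos.1 (by omega))
    have h1 := P.weight_le_erase hr (by omega) huni hxd
    have h2 := ih (T := T.erase x) (fun U hU => hdeg U (hU.trans (Finset.erase_subset _ _)))
      (by rw [Finset.card_erase_of_mem hx]; omega)
    rw [Nat.mul_succ]
    omega

/-- A vertex set of large weight and large minimum degree. -/
theorem PairSystem.exists_dense [Fintype V] (P : PairSystem H) {r s M E : ℕ} (hr : 3 ≤ r)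
    (hrs : r + 3 ≤ s) (hM : r + 3 ≤ M) (hsM : s ≤ M) (hMV : M ≤ Fintype.card V)
    (huni : ∀ e ∈ H, e.card = r)
    (hH : s.choose (r - 1) * (Fintype.card V - s) + E ≤ H.card)
    (hV : M.choose r + s.choose (r - 1) * s < Fintype.card V + E) :
    ∃ T : Finset V, M < T.card ∧
      s.choose (r - 1) * (T.card - s) + E + (Fintype.card V - T.card) ≤ P.weight T ∧
      ∀ x ∈ T, s ≤ (T.filter (P.graph.Adj x)).card := by
  set D := s.choose (r - 1) with hD
  have hDpos : 0 < D := Nat.choose_pos (by omega)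
  obtain ⟨T, hT, hTmin⟩ := Finset.exists_min_image
    (Finset.univ.filter (fun U : Finset V =>
      H.card ≤ P.weight U + (D - 1) * (Fintype.card V - U.card)))
    Finset.card ⟨Finset.univ, by simp [P.weight_univ]⟩
  simp only [Finset.mem_filter, Finset.mem_univ, true_and] at hT hTmin
  obtain ⟨D', hD'⟩ : ∃ D', D = D' + 1 := ⟨D - 1, by omega⟩
  have hTn : T.card ≤ Fintype.card V := Finset.card_le_univ T
  rw [hD'] at hT hTmin hH hV
  simp only [Nat.add_sub_cancel] at hT hTmin
  obtain ⟨a, ha⟩ : ∃ a, Fintype.card V = T.card + a := ⟨_, (Nat.add_sub_cancel' hTn).symm⟩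
  obtain ⟨b, hb⟩ : ∃ b, Fintype.card V = s + b := ⟨Fintype.card V - s, by omega⟩
  rw [show Fintype.card V - T.card = a by omega] at hT
  rw [show Fintype.card V - s = b by omega] at hH
  have hMT : M < T.card := by
    by_contra hcon
    push Not at hcon
    obtain ⟨U, hTU, hU⟩ := Finset.exists_superset_card_eq hcon hMV
    have h1 := P.weight_mono hTU
    have h2 := P.weight_le_choose hr huni (U := U) (by omega)
    rw [hU] at h2
    have h3 : D' * a ≤ D' * (s + b) := Nat.mul_le_mul_left _ (by omega)
    have h4 : (D' + 1) * b = D' * b + b := by ring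
    have h5 : (D' + 1) * s = D' * s + s := by ring
    have h6 : D' * (s + b) = D' * s + D' * b := by ring
    omega
  refine ⟨T, hMT, ?_, ?_⟩
  · obtain ⟨e, he⟩ : ∃ e, T.card = s + e := ⟨T.card - s, by omega⟩
    rw [show T.card - s = e by omega, show Fintype.card V - T.card = a by omega, hD']
    have h1 : b = e + a := by omega
    have h2 : (D' + 1) * b = (D' + 1) * e + D' * a + a := by rw [h1]; ring
    omega
  · intro x hx
    by_contra hcon
    push Not at hcon
    have h1 := P.weight_lt_erase hr (by omega) huni (U := T) (x := x) (s := s) (by omega)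
    rw [← hD, hD'] at h1
    have hcard := Finset.card_erase_of_mem hx
    have h2 := hTmin (T.erase x)
    have h3 : Fintype.card V - (T.erase x).card = a + 1 := by omega
    rw [h3, Nat.mul_succ] at h2
    have := h2 (by omega)
    omega

end Weight

section BergeLists

variable {V : Type*}

/-- `vs` and `es` are the vertices and hyperedges of a Berge walk. -/
def IsBergeList : List V → List (Finset V) → Prop
  | [_], [] => True
  | x :: y :: vs, e :: es => x ∈ e ∧ y ∈ e ∧ IsBergeList (y :: vs) es
  | _, _ => False

theorem isBergeList_iff {vs : List V} {es : List (Finset V)} :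
    IsBergeList vs es ↔ vs.length = es.length + 1 ∧
      ∀ i (h : i < es.length) (h' : i + 1 < vs.length), vs[i] ∈ es[i] ∧ vs[i + 1] ∈ es[i] := by
  induction es generalizing vs with
  | nil =>
    match vs with
    | [] => simp [IsBergeList]
    | [x] => simp [IsBergeList]
    | x :: y :: vs => simp [IsBergeList]
  | cons e es ih =>
    match vs with
    | [] => simp [IsBergeList]
    | [x] => simp [IsBergeList]
    | x :: y :: vs =>
      simp only [IsBergeList, ih]
      constructor
      · rintro ⟨h1, h2, h3, h4⟩
        refine ⟨by simpa using h3, ?_⟩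
        intro i hi hi'
        match i with
        | 0 => exact ⟨h1, h2⟩
        | i + 1 => exact h4 i (by simpa using hi) (by simpa using hi')
      · rintro ⟨h3, h4⟩
        have h0 := h4 0 (by simp) (by simp)
        refine ⟨h0.1, h0.2, by simpa using h3, fun i hi hi' => ?_⟩
        exact h4 (i + 1) (by simpa using hi) (by simpa using hi')

theorem IsBergeList.append {vs vs' : List V} {es es' : List (Finset V)} {e : Finset V}
    (h : IsBergeList vs es) (h' : IsBergeList vs' es') (he : ∀ x ∈ vs.getLast?, x ∈ e)
    (he' : ∀ y ∈ vs'.head?, y ∈ e) : IsBergeList (vs ++ vs') (es ++ e :: es') := by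
  induction es generalizing vs with
  | nil =>
    match vs, h with
    | [x], _ =>
      match vs', h' with
      | y :: vs', h' =>
        have h1 : x ∈ e := he x (by simp)
        have h2 : y ∈ e := he' y (by simp)
        exact ⟨h1, h2, h'⟩
  | cons f es ih =>
    match vs, h with
    | x :: y :: vs, h =>
      refine ⟨h.1, h.2.1, ih h.2.2 ?_⟩
      intro z hz
      apply he
      rw [Option.mem_def] at hz ⊢
      rw [List.getLast?_cons_cons]
      exact hz

theorem IsBergeList.split_edge {vs : List V} {es es' : List (Finset V)} {e : Finset V}
    (h : IsBergeList vs (es ++ e :: es')) : ∃ vs1 vs2, vs = vs1 ++ vs2 ∧ IsBergeList vs1 es ∧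
      IsBergeList vs2 es' ∧ (∀ x ∈ vs1.getLast?, x ∈ e) ∧ ∀ y ∈ vs2.head?, y ∈ e := by
  induction es generalizing vs with
  | nil =>
    match vs, h with
    | x :: y :: vs, h =>
      refine ⟨[x], y :: vs, rfl, trivial, h.2.2, ?_, ?_⟩
      · intro z hz; simp at hz; exact hz ▸ h.1
      · intro z hz; simp at hz; exact hz ▸ h.2.1
  | cons f es ih =>
    match vs, h with
    | x :: y :: vs, h =>
      obtain ⟨vs1, vs2, h1, h2, h3, h4, h5⟩ := ih h.2.2
      match vs1, h2 with
      | z :: vs1, h2 =>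
        obtain ⟨rfl, rfl⟩ := List.cons.inj h1
        refine ⟨x :: y :: vs1, vs2, rfl, ⟨h.1, h.2.1, h2⟩, h3, ?_, h5⟩
        intro z hz
        apply h4
        rw [Option.mem_def] at hz ⊢
        rwa [List.getLast?_cons_cons] at hz

theorem IsBergeList.split_vertex {a b : List V} {z : V} {es : List (Finset V)}
    (h : IsBergeList (a ++ z :: b) es) : ∃ es1 es2, es = es1 ++ es2 ∧ es1.length = a.length ∧
      es2.length = b.length ∧ IsBergeList (a ++ [z]) es1 ∧ IsBergeList (z :: b) es2 := by
  have hlen := (isBergeList_iff.1 h).1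
  induction a generalizing es with
  | nil =>
    refine ⟨[], es, rfl, rfl, ?_, trivial, h⟩
    simp at hlen
    omega
  | cons x a ih =>
    match es, h with
    | [], h => simp at hlen
    | e :: es, h =>
      match a with
      | [] =>
        have h' : IsBergeList (x :: z :: b) (e :: es) := h
        refine ⟨[e], es, rfl, rfl, by simpa using hlen.symm, ⟨h'.1, h'.2.1, trivial⟩, h'.2.2⟩
      | y :: a =>
        have h' : IsBergeList (x :: y :: (a ++ z :: b)) (e :: es) := h
        obtain ⟨es1, es2, rfl, h1, h2, h3, h4⟩ := ih h'.2.2 (by simpa using hlen)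
        exact ⟨e :: es1, es2, rfl, by simp [h1], h2, ⟨h'.1, h'.2.1, h3⟩, h4⟩

theorem BergePath.exists_list {H : Finset (Finset V)} {t : ℕ} (Q : BergePath H t) :
    ∃ vs es, IsBergeList vs es ∧ vs.Nodup ∧ es.Nodup ∧ (∀ e ∈ es, e ∈ H) ∧
      vs.head? = some (Q.verts 0) ∧ vs.getLast? = some (Q.verts (Fin.last t)) := by
  refine ⟨List.ofFn Q.verts, List.ofFn Q.edges, ?_, List.nodup_ofFn.2 Q.verts_inj,
    List.nodup_ofFn.2 Q.edges_inj, ?_, ?_, ?_⟩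
  · rw [isBergeList_iff]
    refine ⟨by simp, fun i hi hi' => ?_⟩
    simp only [List.length_ofFn] at hi hi'
    simp only [List.getElem_ofFn]
    exact ⟨Q.fst_mem ⟨i, hi⟩, Q.snd_mem ⟨i, hi⟩⟩
  · intro e he
    obtain ⟨i, rfl⟩ := (List.mem_ofFn' _ _).1 he
    exact Q.edges_mem i
  · simp
  · rw [List.getLast?_eq_getElem?, List.length_ofFn, List.getElem?_ofFn]
    simp [Fin.last]

theorem IsBergeList.nonempty_bergePath {H : Finset (Finset V)} {vs : List V}
    {es : List (Finset V)} {k : ℕ} (h : IsBergeList vs es) (hvs : vs.Nodup) (hes : es.Nodup)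
    (hH : ∀ e ∈ es, e ∈ H) (hk : k ≤ es.length) : Nonempty (BergePath H k) := by
  obtain ⟨h1, h2⟩ := isBergeList_iff.1 h
  refine ⟨⟨fun i => vs[i.1]'(by omega), fun i => es[i.1]'(by omega), ?_, ?_, ?_, ?_, ?_⟩⟩
  · intro i j hij
    exact Fin.ext ((List.Nodup.getElem_inj_iff hvs).1 hij)
  · intro i j hij
    exact Fin.ext ((List.Nodup.getElem_inj_iff hes).1 hij)
  · intro i
    exact hH _ (List.getElem_mem _)
  · intro i
    exact (h2 i.1 (by omega) (by omega)).1
  · intro i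
    exact (h2 i.1 (by omega) (by omega)).2

end BergeLists

section Link

variable {V : Type*} {H : Finset (Finset V)}

theorem PairSystem.exists_bergeList (P : PairSystem H) {Q : V → V → Prop}
    (hQ : ∀ u v, Q u v → P.graph.Adj u v) {l : List V} (hne : l ≠ []) (hnd : l.Nodup)
    (hch : l.IsChain Q) : ∃ es, IsBergeList l es ∧ es.Nodup ∧
      ∀ e ∈ es, ∃ u ∈ l, ∃ v ∈ l, Q u v ∧ e = P.rep {u, v} := by
  induction l with
  | nil => exact absurd rfl hne
  | cons x l ih =>
    match l with
    | [] => exact ⟨[], trivial, by simp, by simp⟩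
    | y :: l =>
      rw [List.nodup_cons] at hnd
      rw [List.isChain_cons_cons] at hch
      obtain ⟨es, h1, h2, h3⟩ := ih (by simp) hnd.2 hch.2
      have hxy := hQ _ _ hch.1
      refine ⟨P.rep {x, y} :: es, ⟨?_, ?_, h1⟩, ?_, ?_⟩
      · exact P.sub_rep _ hxy.2 (by simp)
      · exact P.sub_rep _ hxy.2 (by simp)
      · rw [List.nodup_cons]
        refine ⟨fun hmem => ?_, h2⟩
        obtain ⟨u, hu, v, hv, huv, heq⟩ := h3 _ hmem
        have hp := P.rep_inj _ hxy.2 _ (hQ _ _ huv).2 heq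
        have hx : x ∈ ({u, v} : Finset V) := by rw [← hp]; simp
        simp only [Finset.mem_insert, Finset.mem_singleton] at hx
        rcases hx with rfl | rfl
        · exact hnd.1 hu
        · exact hnd.1 hv
      · intro e he
        rcases List.mem_cons.1 he with rfl | he
        · exact ⟨x, by simp, y, by simp, hch.1, rfl⟩
        · obtain ⟨u, hu, v, hv, huv, heq⟩ := h3 e he
          exact ⟨u, List.mem_cons_of_mem _ hu, v, List.mem_cons_of_mem _ hv, huv, heq⟩

theorem PairSystem.path_length_le (P : PairSystem H) {k : ℕ} (hpath : IsEmpty (BergePath H k))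
    {l : List V} (hnd : l.Nodup) (hch : l.IsChain P.graph.Adj) : l.length ≤ k := by
  by_contra hcon
  push Not at hcon
  obtain ⟨es, h1, h2, h3⟩ := P.exists_bergeList (fun _ _ h => h)
    (by rintro rfl; simp at hcon) hnd hch
  have hlen := (isBergeList_iff.1 h1).1
  refine hpath.elim (h1.nonempty_bergePath (k := k) hnd h2 ?_ (by omega)).some
  intro e he
  obtain ⟨u, -, v, -, huv, rfl⟩ := h3 e he
  exact P.rep_mem _ huv.2

/-- Inside a set of minimum degree `d`, a hyperedge `h` meeting the set has a vertex from which a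
path with `d + 1` vertices starts that does not use `h`. -/
theorem PairSystem.exists_path_from (P : PairSystem H) {U h : Finset V} {d : ℕ} (hd : 2 ≤ d)
    (hdeg : ∀ x ∈ U, d ≤ (U.filter (P.graph.Adj x)).card) (hU : (h ∩ U).Nonempty) :
    ∃ y ∈ h, ∃ l : List V, l.head? = some y ∧ l.Nodup ∧ (∀ z ∈ l, z ∈ U) ∧
      l.IsChain (fun u v => P.graph.Adj u v ∧ P.rep {u, v} ≠ h) ∧ d + 1 ≤ l.length := by
  obtain ⟨y, hyh, hyU, hy1, hy2⟩ : ∃ y ∈ h, y ∈ U ∧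
      (∀ w z, w ∈ U → z ∈ U → P.graph.Adj w z → P.rep {w, z} = h → w ≠ y → z = y) ∧
      ∃ z ∈ U, P.graph.Adj y z ∧ P.rep {y, z} ≠ h := by
    by_cases hex : ∃ a ∈ U, ∃ b ∈ U, P.graph.Adj a b ∧ P.rep {a, b} = h
    · obtain ⟨a, ha, b, hb, hab, hrep⟩ := hex
      have hah : a ∈ h := hrep ▸ P.sub_rep _ hab.2 (by simp)
      have huniq : ∀ w z, P.graph.Adj w z → P.rep {w, z} = h → ({w, z} : Finset V) = {a, b} :=
        fun w z hwz hw => P.rep_inj _ hwz.2 _ hab.2 (hw.trans hrep.symm)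
      refine ⟨a, hah, ha, ?_, ?_⟩
      · intro w z _ _ hwz hw hwa
        have := huniq w z hwz hw
        have ha' : a ∈ ({w, z} : Finset V) := by rw [this]; simp
        simp only [Finset.mem_insert, Finset.mem_singleton] at ha'
        exact (ha'.resolve_left (Ne.symm hwa)).symm
      · have h1 := hdeg a ha
        obtain ⟨z, hz⟩ : ((U.filter (P.graph.Adj a)).erase b).Nonempty := by
          rw [← Finset.card_pos]
          have := Finset.pred_card_le_card_erase (s := U.filter (P.graph.Adj a)) (a := b)
          omega
        rw [Finset.mem_erase, Finset.mem_filter] at hz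
        refine ⟨z, hz.2.1, hz.2.2, fun hh => hz.1 ?_⟩
        have := huniq a z hz.2.2 hh
        have hz' : z ∈ ({a, b} : Finset V) := by rw [← this]; simp
        simp only [Finset.mem_insert, Finset.mem_singleton] at hz'
        exact hz'.resolve_left hz.2.2.ne'
    · push Not at hex
      obtain ⟨y, hy⟩ := hU
      rw [Finset.mem_inter] at hy
      refine ⟨y, hy.1, hy.2, fun w z hw hz hwz hh => absurd hh (hex w hw z hz hwz), ?_⟩
      obtain ⟨z, hz⟩ : (U.filter (P.graph.Adj y)).Nonempty :=
        Finset.card_pos.1 (by have := hdeg y hy.2; omega)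
      rw [Finset.mem_filter] at hz
      exact ⟨z, hz.1, hz.2, hex y hy.2 z hz.1 hz.2⟩
  let Pr : ℕ → Prop := fun m => ∃ l : List V, l.head? = some y ∧ l.Nodup ∧ (∀ z ∈ l, z ∈ U) ∧
      l.IsChain (fun u v => P.graph.Adj u v ∧ P.rep {u, v} ≠ h) ∧ l.length = m
  have hb : ∀ m, Pr m → m ≤ U.card := by
    rintro m ⟨l, -, h2, h3, -, rfl⟩
    rw [← List.toFinset_card_of_nodup h2]
    exact Finset.card_le_card (fun z hz => h3 z (List.mem_toFinset.1 hz))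
  have h1 : Pr 1 := ⟨[y], by simp, by simp, by simpa using hyU, by simp, rfl⟩
  obtain ⟨l, hl1, hl2, hl3, hl4, hl5⟩ := Nat.findGreatest_spec (P := Pr) (hb 1 h1) h1
  refine ⟨y, hyh, l, hl1, hl2, hl3, hl4, ?_⟩
  have hmax : ∀ m, Pr m → m ≤ l.length := by
    intro m hm
    rw [hl5]
    exact Nat.le_findGreatest (hb m hm) hm
  have hlne : l ≠ [] := by rintro rfl; simp at hl1
  obtain ⟨l0, w, rfl⟩ : ∃ l0 w, l = l0 ++ [w] :=
    ⟨_, _, (List.dropLast_append_getLast hlne).symm⟩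
  have hwU : w ∈ U := hl3 w (by simp)
  have hclosed : ∀ z ∈ U, P.graph.Adj w z → P.rep {w, z} ≠ h → z ∈ l0 ++ [w] := by
    intro z hz hwz hh
    by_contra hzl
    have : Pr ((l0 ++ [w] ++ [z]).length) := by
      refine ⟨l0 ++ [w] ++ [z], ?_, ?_, ?_, ?_, rfl⟩
      · rw [List.head?_append, hl1]; rfl
      · rw [List.nodup_append]
        refine ⟨hl2, by simp, ?_⟩
        intro a ha b hb hab
        simp only [List.mem_singleton] at hb
        subst hab; subst hb
        exact hzl ha
      · intro a ha
        rcases List.mem_append.1 ha with ha | ha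
        · exact hl3 a ha
        · simp only [List.mem_singleton] at ha
          exact ha ▸ hz
      · rw [List.isChain_append]
        refine ⟨hl4, by simp, ?_⟩
        intro a ha b hb
        obtain rfl : w = a := by simpa using ha
        obtain rfl : z = b := by simpa using hb
        exact ⟨hwz, hh⟩
    have := hmax _ this
    simp at this
  have hyl : y ∈ l0 ++ [w] := List.mem_of_head? hl1
  have hwy : w ≠ y := by
    rintro rfl
    obtain ⟨z, hz, hz1, hz2⟩ := hy2
    have := hclosed z hz hz1 hz2
    have hzw : z ≠ w := hz1.ne'
    match l0 with
    | [] => simp [hzw] at this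
    | a :: l0 =>
      obtain rfl : a = w := by simpa using hl1
      simp at hl2
  have hsub : U.filter (P.graph.Adj w) ⊆ l0.toFinset := by
    intro z hz
    rw [Finset.mem_filter] at hz
    have hzl : z ∈ l0 ++ [w] := by
      by_cases hh : P.rep {w, z} = h
      · rw [hy1 w z hwU hz.1 hz.2 hh hwy]; exact hyl
      · exact hclosed z hz.1 hz.2 hh
    have hzw : z ≠ w := hz.2.ne'
    simp [hzw] at hzl
    simpa using hzl
  have e1 := Finset.card_le_card hsub
  have e2 := List.toFinset_card_le l0
  have e3 := hdeg w hwU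
  simp
  omega

end Link

section Connectivity

variable {V : Type*} {H : Finset (Finset V)}

theorem IsBergeList.reverse {vs : List V} {es : List (Finset V)} (h : IsBergeList vs es) :
    IsBergeList vs.reverse es.reverse := by
  induction es generalizing vs with
  | nil =>
    match vs, h with
    | [x], _ => trivial
  | cons e es ih =>
    match vs, h with
    | x :: y :: vs, h =>
      have := (ih h.2.2).append (vs' := [x]) (es' := []) (e := e) trivial
        (by simpa using h.2.1) (by simpa using h.1)
      simpa using this

/-- `vs` and `es` are the vertices and hyperedges of a Berge path from `U` to `K`. -/
structure IsBergeLink (H : Finset (Finset V)) (U K : Finset V) (vs : List V)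
    (es : List (Finset V)) : Prop where
  isBergeList : IsBergeList vs es
  nodup_verts : vs.Nodup
  nodup_edges : es.Nodup
  edges_mem : ∀ e ∈ es, e ∈ H
  head_mem : ∃ x ∈ U, vs.head? = some x
  last_mem : ∃ y ∈ K, vs.getLast? = some y

theorem IsBergeLink.symm {U K : Finset V} {vs : List V} {es : List (Finset V)}
    (h : IsBergeLink H U K vs es) : IsBergeLink H K U vs.reverse es.reverse where
  isBergeList := h.isBergeList.reverse
  nodup_verts := List.nodup_reverse.2 h.nodup_verts
  nodup_edges := List.nodup_reverse.2 h.nodup_edges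
  edges_mem e he := h.edges_mem e (List.mem_reverse.1 he)
  head_mem := by simpa using h.last_mem
  last_mem := by simpa using h.head_mem

/-- A shortest Berge path from `U` to `K` meets `U` only in its first vertex and its first
hyperedge. -/
theorem IsBergeLink.disjoint_of_minimal {U K : Finset V} {x : V} {vs : List V} {h : Finset V}
    {es : List (Finset V)} (hl : IsBergeLink H U K (x :: vs) (h :: es))
    (hmin : ∀ vs' es', IsBergeLink H U K vs' es' → es.length + 1 ≤ es'.length) :
    (∀ z ∈ vs, z ∉ U) ∧ ∀ e ∈ es, Disjoint e U := by
  have hvs : ∀ z ∈ vs, z ∉ U := by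
    intro z hz hzU
    obtain ⟨a, b, rfl⟩ := List.append_of_mem hz
    have hB : IsBergeList ((x :: a) ++ z :: b) (h :: es) := hl.isBergeList
    obtain ⟨es1, es2, h1, h2, h3, -, h5⟩ := hB.split_vertex
    have hsub : es2 <:+ h :: es := ⟨es1, h1.symm⟩
    have hlen := congrArg List.length h1
    have := hmin (z :: b) es2 {
      isBergeList := h5
      nodup_verts := (List.nodup_append.1 (List.nodup_cons.1 hl.nodup_verts).2).2.1
      nodup_edges := hl.nodup_edges.sublist hsub.sublist
      edges_mem := fun e he => hl.edges_mem e (hsub.subset he)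
      head_mem := ⟨z, hzU, rfl⟩
      last_mem := by
        obtain ⟨y, hy, hy'⟩ := hl.last_mem
        refine ⟨y, hy, ?_⟩
        rw [← hy']
        exact (List.getLast?_append_cons (x :: a) z b).symm }
    simp at hlen h2
    omega
  refine ⟨hvs, fun e he => ?_⟩
  rw [Finset.disjoint_left]
  intro y hye hyU
  obtain ⟨es1, es2, rfl⟩ := List.append_of_mem he
  have hB : IsBergeList (x :: vs) ((h :: es1) ++ e :: es2) := hl.isBergeList
  obtain ⟨vs1, vs2, h1, h2, h3, -, h5⟩ := hB.split_edge
  match vs1, h2 with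
  | x' :: vs1, h2 =>
    obtain ⟨rfl, rfl⟩ := List.cons.inj h1
    match vs2, h3 with
    | z :: vs2, h3 =>
      have hsub : e :: es2 <:+ h :: (es1 ++ e :: es2) := ⟨h :: es1, rfl⟩
      have hn := (List.nodup_append.1 (List.nodup_cons.1 hl.nodup_verts).2).2.1
      have := hmin (y :: z :: vs2) (e :: es2) {
        isBergeList := ⟨hye, h5 z rfl, h3⟩
        nodup_verts := List.nodup_cons.2 ⟨fun hy => hvs y (List.mem_append_right _ hy) hyU, hn⟩
        nodup_edges := hl.nodup_edges.sublist hsub.sublist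
        edges_mem := fun e he => hl.edges_mem e (hsub.subset he)
        head_mem := ⟨y, hyU, rfl⟩
        last_mem := by
          obtain ⟨y', hy, hy'⟩ := hl.last_mem
          refine ⟨y', hy, ?_⟩
          rw [← hy', List.getLast?_cons_cons]
          exact (List.getLast?_append_cons (x :: vs1) z vs2).symm }
      simp at this
      omega

/-- If a Berge path starts in a set `U` of minimum degree `d` and does not return there, its first
vertex can be replaced by a path inside `U` with `d + 1` vertices. -/
theorem PairSystem.exists_extend (P : PairSystem H) {U : Finset V} {d : ℕ} (hd : 2 ≤ d)
    (hdeg : ∀ x ∈ U, d ≤ (U.filter (P.graph.Adj x)).card) {x : V} {vs : List V} {h : Finset V}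
    {es : List (Finset V)} (hB : IsBergeList (x :: vs) (h :: es)) (hvs : vs.Nodup)
    (hes : (h :: es).Nodup) (hx : x ∈ U) (hvU : ∀ z ∈ vs, z ∉ U)
    (hrep : ∀ u ∈ U, ∀ v ∈ U, P.graph.Adj u v → P.rep {u, v} ∉ es) :
    ∃ l es', IsBergeList (l ++ vs) (es' ++ h :: es) ∧ (l ++ vs).Nodup ∧
      (es' ++ h :: es).Nodup ∧ (∀ z ∈ l, z ∈ U) ∧
      (∀ e ∈ es', ∃ u ∈ U, ∃ v ∈ U, P.graph.Adj u v ∧ e = P.rep {u, v}) ∧ d ≤ es'.length := by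
  match vs, hB with
  | y :: vs, hB =>
    obtain ⟨x', hx', l, hl1, hl2, hl3, hl4, hl5⟩ := P.exists_path_from (h := h) hd hdeg
      ⟨x, Finset.mem_inter.2 ⟨hB.1, hx⟩⟩
    obtain ⟨es', he1, he2, he3⟩ := P.exists_bergeList (fun _ _ h => h.1)
      (by rintro rfl; simp at hl5) hl2 hl4
    have hlen := (isBergeList_iff.1 he1).1
    refine ⟨l.reverse, es'.reverse, he1.reverse.append hB.2.2 ?_ ?_, ?_, ?_, ?_, ?_, ?_⟩
    · intro z hz
      rw [List.getLast?_reverse, hl1] at hz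
      obtain rfl : x' = z := by simpa using hz
      exact hx'
    · intro z hz
      obtain rfl : y = z := by simpa using hz
      exact hB.2.1
    · rw [List.nodup_append]
      refine ⟨List.nodup_reverse.2 hl2, hvs, ?_⟩
      rintro a ha b hb rfl
      exact hvU a hb (hl3 a (List.mem_reverse.1 ha))
    · rw [List.nodup_append]
      refine ⟨List.nodup_reverse.2 he2, hes, ?_⟩
      rintro a ha b hb rfl
      obtain ⟨u, hu, v, hv, huv, rfl⟩ := he3 a (List.mem_reverse.1 ha)
      rcases List.mem_cons.1 hb with hb | hb
      · exact huv.2 hb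
      · exact hrep u (hl3 u hu) v (hl3 v hv) huv.1 hb
    · intro z hz
      exact hl3 z (List.mem_reverse.1 hz)
    · intro e he
      obtain ⟨u, hu, v, hv, huv, rfl⟩ := he3 e (List.mem_reverse.1 he)
      exact ⟨u, hl3 u hu, v, hl3 v hv, huv.1, rfl⟩
    · rw [List.length_reverse]
      omega

/-- In a connected hypergraph, two disjoint sets of minimum degrees `d₁` and `d₂` give rise to a
Berge path of length `d₁ + d₂ + 1`. -/
theorem PairSystem.nonempty_bergePath_of_disjoint (P : PairSystem H) (hconn : HConnected H)
    {U K : Finset V} {d₁ d₂ k : ℕ} (hd₁ : 2 ≤ d₁) (hd₂ : 2 ≤ d₂) (hk : k ≤ d₁ + d₂ + 1)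
    (hUK : Disjoint U K) (hU : U.Nonempty) (hK : K.Nonempty)
    (hdegU : ∀ x ∈ U, d₁ ≤ (U.filter (P.graph.Adj x)).card)
    (hdegK : ∀ x ∈ K, d₂ ≤ (K.filter (P.graph.Adj x)).card) : Nonempty (BergePath H k) := by
  have hne : ∀ x ∈ U, ∀ y ∈ K, x ≠ y := fun x hx y hy h =>
    Finset.disjoint_left.1 hUK hx (h ▸ hy)
  have hex : ∃ m vs es, IsBergeLink H U K vs es ∧ es.length = m := by
    obtain ⟨x, hx⟩ := hU
    obtain ⟨y, hy⟩ := hK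
    obtain ⟨t, Q, hQ1, hQ2⟩ := hconn x y (hne x hx y hy)
    obtain ⟨vs, es, h1, h2, h3, h4, h5, h6⟩ := Q.exists_list
    exact ⟨_, vs, es, ⟨h1, h2, h3, h4, ⟨x, hx, hQ1 ▸ h5⟩, ⟨y, hy, hQ2 ▸ h6⟩⟩, rfl⟩
  obtain ⟨vs, es, hl, hm⟩ := Nat.find_spec hex
  have hmin : ∀ vs' es', IsBergeLink H U K vs' es' → es.length ≤ es'.length := fun vs' es' h' =>
    hm ▸ Nat.find_min' hex ⟨vs', es', h', rfl⟩
  clear hm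
  obtain ⟨x, hxU, hx⟩ := hl.head_mem
  obtain ⟨y, hyK, hy⟩ := hl.last_mem
  obtain ⟨vs, rfl⟩ : ∃ vs', vs = x :: vs' := by
    match vs, hx with
    | _ :: vs', hx => exact ⟨vs', by simpa using hx⟩
  match es with
  | [] =>
    match vs, hl.isBergeList with
    | [], _ => exact absurd (by simpa using hy) (hne x hxU y hyK)
  | h :: es =>
    obtain ⟨hvU, heU⟩ := hl.disjoint_of_minimal hmin
    have hvne : vs ≠ [] := by
      rintro rfl
      exact hl.isBergeList
    obtain ⟨vs, rfl⟩ : ∃ vs', vs = vs' ++ [y] := by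
      refine ⟨vs.dropLast, ?_⟩
      have h1 := (List.dropLast_append_getLast hvne).symm
      rw [List.getLast?_cons, List.getLast?_eq_getLast_of_ne_nil hvne] at hy
      have h2 : vs.getLast hvne = y := by simpa using hy
      rwa [h2] at h1
    obtain ⟨em, h', hee⟩ : ∃ em h', h :: es = em ++ [h'] :=
      ⟨_, _, (List.dropLast_append_getLast (List.cons_ne_nil h es)).symm⟩
    have hl' : IsBergeLink H K U (y :: (vs.reverse ++ [x])) (h' :: em.reverse) := by
      have := hl.symm
      rw [hee] at this
      simpa using this
    obtain ⟨hvK, heK⟩ := hl'.disjoint_of_minimal (by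
      intro vs' es' h
      have h1 := hmin _ _ h.symm
      rw [hee] at h1
      simpa using h1)
    obtain ⟨l, es', a1, a2, a3, a4, a5, a6⟩ := P.exists_extend hd₁ hdegU hl.isBergeList
      (List.nodup_cons.1 hl.nodup_verts).2 hl.nodup_edges hxU hvU (by
        intro u hu v _ huv hmem
        exact Finset.disjoint_left.1 (heU _ hmem) (P.sub_rep _ huv.2 (by simp)) hu)
    have b1 : IsBergeList (y :: (vs.reverse ++ l.reverse)) (h' :: (em.reverse ++ es'.reverse)) := by
      have := a1.reverse
      rw [hee] at this
      simpa using this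
    obtain ⟨l', es'', c1, c2, c3, -, c5, c6⟩ := P.exists_extend hd₂ hdegK b1
      (by
        have := List.nodup_reverse.2 a2
        simp only [List.reverse_append, List.append_assoc] at this
        exact (List.nodup_cons.1 (by simpa using this)).2)
      (by
        have := List.nodup_reverse.2 a3
        rw [hee] at this
        simpa using this)
      hyK
      (by
        intro z hz
        rcases List.mem_append.1 hz with hz | hz
        · exact hvK z (List.mem_append_left _ hz)
        · intro hzK
          exact hne z (a4 z (List.mem_reverse.1 hz)) z hzK rfl)
      (by
        intro u hu v _ huv hmem
        rcases List.mem_append.1 hmem with hmem | hmem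
        · exact Finset.disjoint_left.1 (heK _ hmem) (P.sub_rep _ huv.2 (by simp)) hu
        · obtain ⟨w, hw, z, hz, hwz, hh⟩ := a5 _ (List.mem_reverse.1 hmem)
          have hp := P.rep_inj _ huv.2 _ hwz.2 hh
          have hu' : u ∈ ({w, z} : Finset V) := by rw [← hp]; simp
          simp only [Finset.mem_insert, Finset.mem_singleton] at hu'
          rcases hu' with rfl | rfl
          · exact hne u hw u hu rfl
          · exact hne u hz u hu rfl)
    refine c1.nonempty_bergePath c2 c3 ?_ ?_
    · intro e he
      rcases List.mem_append.1 he with he | he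
      · obtain ⟨u, -, v, -, huv, rfl⟩ := c5 e he
        exact P.rep_mem _ huv.2
      · rw [List.mem_cons, List.mem_append] at he
        rcases he with rfl | he | he
        · exact hl'.edges_mem e (by simp)
        · exact hl'.edges_mem e (List.mem_cons_of_mem _ he)
        · obtain ⟨u, -, v, -, huv, rfl⟩ := a5 e (List.mem_reverse.1 he)
          exact P.rep_mem _ huv.2
    · simp
      omega

/-- A dense set cannot be split into two parts without edges of the pair graph between them. -/
theorem PairSystem.exists_adj_of_cut (P : PairSystem H) {r s k : ℕ} (hr : 3 ≤ r)
    (hrs : r + 3 ≤ s) (hk : k ≤ 2 * s + 2) (huni : ∀ e ∈ H, e.card = r) (hconn : HConnected H)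
    (hpath : IsEmpty (BergePath H k)) {T : Finset V} (hsT : s ≤ T.card)
    (hT : ∀ x ∈ T, s ≤ (T.filter (P.graph.Adj x)).card)
    (hw : k = 2 * s + 2 → s.choose (r - 1) * (T.card - s) + s.choose r < P.weight T)
    {K : Finset V} (hKT : K ⊆ T) (hK : K.Nonempty) (hK' : (T \ K).Nonempty) :
    ∃ a ∈ K, ∃ b ∈ T \ K, P.graph.Adj a b := by
  by_contra hcon
  push Not at hcon
  have key : ∀ U ⊆ T, ∀ x ∈ U, (x ∈ K → U.filter (P.graph.Adj x) ⊆ (U ∩ K).filter (P.graph.Adj x))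
      ∧ (x ∉ K → U.filter (P.graph.Adj x) ⊆ (U \ K).filter (P.graph.Adj x)) := by
    intro U hU x hx
    refine ⟨fun hxK z hz => ?_, fun hxK z hz => ?_⟩
    · rw [Finset.mem_filter] at hz ⊢
      refine ⟨Finset.mem_inter.2 ⟨hz.1, ?_⟩, hz.2⟩
      by_contra hzK
      exact hcon x hxK z (Finset.mem_sdiff.2 ⟨hU hz.1, hzK⟩) hz.2
    · rw [Finset.mem_filter] at hz ⊢
      refine ⟨Finset.mem_sdiff.2 ⟨hz.1, ?_⟩, hz.2⟩
      intro hzK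
      exact hcon z hzK x (Finset.mem_sdiff.2 ⟨hU hx, hxK⟩) hz.2.symm
  have dK : ∀ x ∈ K, s ≤ (K.filter (P.graph.Adj x)).card := by
    intro x hx
    have := (key T subset_rfl x (hKT hx)).1 hx
    rw [Finset.inter_eq_right.2 hKT] at this
    exact (hT x (hKT hx)).trans (Finset.card_le_card this)
  have dK' : ∀ x ∈ T \ K, s ≤ ((T \ K).filter (P.graph.Adj x)).card := by
    intro x hx
    rw [Finset.mem_sdiff] at hx
    exact (hT x hx.1).trans (Finset.card_le_card ((key T subset_rfl x hx.1).2 hx.2))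
  have hdis : Disjoint K (T \ K) := Finset.disjoint_sdiff
  rcases Nat.lt_or_ge k (2 * s + 2) with hk' | hk'
  · exact not_isEmpty_iff.2 (P.nonempty_bergePath_of_disjoint hconn (k := k) (d₁ := s) (d₂ := s)
      (by omega) (by omega) (by omega) hdis hK hK' dK dK') hpath
  have hk2 : k = 2 * s + 2 := le_antisymm hk hk'
  by_cases hU : ∃ U ⊆ T, U.Nonempty ∧ ∀ x ∈ U, s + 1 ≤ (U.filter (P.graph.Adj x)).card
  · obtain ⟨U, hUT, ⟨x, hx⟩, hUd⟩ := hU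
    by_cases hxK : x ∈ K
    · refine not_isEmpty_iff.2 (P.nonempty_bergePath_of_disjoint hconn (k := k) (d₁ := s + 1)
        (d₂ := s) (U := U ∩ K) (by omega) (by omega) (by omega)
        (hdis.mono_left Finset.inter_subset_right) ⟨x, Finset.mem_inter.2 ⟨hx, hxK⟩⟩ hK' ?_ dK')
        hpath
      intro z hz
      rw [Finset.mem_inter] at hz
      exact (hUd z hz.1).trans (Finset.card_le_card ((key U hUT z hz.1).1 hz.2))
    · refine not_isEmpty_iff.2 (P.nonempty_bergePath_of_disjoint hconn (k := k) (d₁ := s + 1)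
        (d₂ := s) (U := U \ K) (by omega) (by omega) (by omega)
        Finset.sdiff_disjoint ⟨x, Finset.mem_sdiff.2 ⟨hx, hxK⟩⟩ hK ?_ dK) hpath
      intro z hz
      rw [Finset.mem_sdiff] at hz
      exact (hUd z hz.1).trans (Finset.card_le_card ((key U hUT z hz.1).2 hz.2))
  · push Not at hU
    have h1 := hw hk2
    have h2 := P.weight_le_of_degenerate hr hrs huni (T := T)
      (fun U hUT hUne => by
        obtain ⟨x, hx, hlt⟩ := hU U hUT hUne
        exact ⟨x, hx, by omega⟩) (T.card - s) (by omega)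
    omega

end Connectivity

section Dense

variable {V : Type*} {H : Finset (Finset V)}

/-- `PathBounded.trichotomy` for the pair graph on a dense set of vertices. -/
theorem PairSystem.structure_of_dense (P : PairSystem H) {r s k : ℕ} (hr : 3 ≤ r)
    (hrs : r + 3 ≤ s) (hk : k = 2 * s + 1 ∨ k = 2 * s + 2) (huni : ∀ e ∈ H, e.card = r)
    (hconn : HConnected H) (hpath : IsEmpty (BergePath H k)) {T : Finset V}
    (hkT : k + 2 ≤ T.card) (hT : ∀ x ∈ T, s ≤ (T.filter (P.graph.Adj x)).card)
    (hw : k = 2 * s + 2 → s.choose (r - 1) * (T.card - s) + s.choose r < P.weight T) :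
    (k = 2 * s + 2 ∧ ∃ C : Finset V, C.card = s + 1 ∧
      P.weight T ≤ P.weight C + s.choose (r - 1) * (T.card - (s + 1))) ∨
    (∃ C : Finset V, (k = 2 * s + 1 ∧ C.card = s + 1 ∨ k = 2 * s + 2 ∧ C.card = s + 2) ∧
      P.weight T + 1 ≤ P.weight C + s.choose (r - 1) * (T.card - C.card)) ∨
    ∃ A ⊆ T, A.card = s ∧ ((∀ u ∈ T \ A, ∀ z ∈ T, P.graph.Adj u z → z ∈ A) ∨
      (k = 2 * s + 2 ∧ ∃ b1 ∈ T \ A, ∃ b2 ∈ T \ A, b1 ≠ b2 ∧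
        ∀ u ∈ T \ A, u ≠ b1 → u ≠ b2 → ∀ z ∈ T, P.graph.Adj u z → z ∈ A)) := by
  let ι : {x // x ∈ T} ↪ V := Function.Embedding.subtype _
  let Γ : SimpleGraph {x // x ∈ T} := P.graph.comap ι
  have hι : ∀ x, ι x ∈ T := fun x => x.2
  have huniv : (Finset.univ : Finset {x // x ∈ T}).map ι = T := by
    ext x
    simp [ι]
  have hdeg : ∀ (U : Finset {x // x ∈ T}) x [DecidablePred (Γ.Adj x)],
      (U.filter (Γ.Adj x)).card = ((U.map ι).filter (P.graph.Adj (ι x))).card := by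
    intro U x _
    rw [Finset.filter_map, Finset.card_map]
    congr
  have herase : ∀ (U : Finset {x // x ∈ T}) x [DecidableEq {x // x ∈ T}],
      (U.erase x).map ι = (U.map ι).erase (ι x) := fun U x _ => Finset.map_erase ι U x
  have hcardT : Fintype.card {x // x ∈ T} = T.card := by simp
  have hΓ : PathBounded Γ s k := {
    four_le := by omega
    le_k := by omega
    k_le := by omega
    path_le := by
      intro l hnd hch
      rw [← List.length_map (f := ι)]
      refine P.path_length_le hpath (hnd.map ι.injective) ?_
      rw [List.isChain_map]
      exact hch
    conn := by
      rintro Y ⟨y, hy⟩ ⟨y', hy'⟩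
      obtain ⟨a, ha, b, hb, hab⟩ := P.exists_adj_of_cut hr hrs (by omega) huni hconn hpath
        (by omega) hT hw (K := (Finset.univ.filter (· ∈ Y)).map ι)
        (by
          intro x hx
          obtain ⟨z, -, rfl⟩ := Finset.mem_map.1 hx
          exact hι z)
        ⟨ι y, Finset.mem_map_of_mem _ (by simpa using hy)⟩
        ⟨ι y', Finset.mem_sdiff.2 ⟨hι _, by
          rw [Finset.mem_map' ι]
          simpa using hy'⟩⟩
      obtain ⟨a, ha, rfl⟩ := Finset.mem_map.1 ha
      rw [Finset.mem_sdiff] at hb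
      refine ⟨a, by simpa using ha, ⟨b, hb.1⟩, fun hbY => hb.2 ?_, hab⟩
      exact Finset.mem_map.2 ⟨⟨b, hb.1⟩, by simpa using hbY, rfl⟩
    deg := by
      intro x
      rw [hdeg, huniv]
      exact hT _ (hι x) }
  have hmain := hΓ.trichotomy (D := s.choose (r - 1)) (by omega) (fun U => P.weight (U.map ι))
    (by
      intro U x _ hd
      rw [hdeg] at hd
      rw [herase]
      exact P.weight_le_erase hr (by omega) huni hd)
    (by
      intro U x _ hd
      rw [hdeg] at hd
      rw [herase]
      exact P.weight_lt_erase hr (by omega) huni hd)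
  simp only [huniv, hcardT] at hmain
  rcases hmain with ⟨h1, C, h2, h3⟩ | ⟨C, h2, h3⟩ | ⟨A, hA, h⟩
  · exact Or.inl ⟨h1, C.map ι, by rwa [Finset.card_map], h3⟩
  · refine Or.inr (Or.inl ⟨C.map ι, ?_, ?_⟩)
    · rwa [Finset.card_map]
    · rwa [Finset.card_map]
  · refine Or.inr (Or.inr ⟨A.map ι, ?_, by rwa [Finset.card_map], ?_⟩)
    · intro x hx
      obtain ⟨z, -, rfl⟩ := Finset.mem_map.1 hx
      exact hι z
    have hmem : ∀ u ∈ T \ A.map ι, ∃ w : {x // x ∈ T}, ι w = u ∧ w ∉ A := by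
      intro u hu
      rw [Finset.mem_sdiff] at hu
      exact ⟨⟨u, hu.1⟩, rfl, fun h => hu.2 (Finset.mem_map.2 ⟨_, h, rfl⟩)⟩
    have hmem' : ∀ w, w ∉ A → ι w ∈ T \ A.map ι := fun w hw =>
      Finset.mem_sdiff.2 ⟨hι w, by rwa [Finset.mem_map' ι]⟩
    refine h.imp (fun h => ?_) (fun h => ⟨h.1, ?_⟩)
    · intro u hu z hz huz
      obtain ⟨u, rfl, huA⟩ := hmem u hu
      exact Finset.mem_map.2 ⟨⟨z, hz⟩, h u huA ⟨z, hz⟩ huz, rfl⟩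
    · obtain ⟨-, b1, hb1, b2, hb2, hne, h⟩ := h
      refine ⟨ι b1, hmem' _ hb1, ι b2, hmem' _ hb2, fun h => hne (ι.injective h), ?_⟩
      intro u hu hu1 hu2 z hz huz
      obtain ⟨u, rfl, huA⟩ := hmem u hu
      exact Finset.mem_map.2 ⟨⟨z, hz⟩, h u huA (fun h => hu1 (h ▸ rfl)) (fun h => hu2 (h ▸ rfl))
        ⟨z, hz⟩ huz, rfl⟩

end Dense

section Extremal

variable {V : Type*} {H : Finset (Finset V)}

theorem card_HnkFamilyOdd_le (r : ℕ) {T A : Finset V} (hA : A ⊆ T) :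
    (HnkFamilyOdd r T A).card ≤
      A.card.choose (r - 1) * (T.card - A.card) + A.card.choose r := by
  have hsub : HnkFamilyOdd r T A ⊆ Finset.powersetCard r A ∪
      ((T \ A) ×ˢ Finset.powersetCard (r - 1) A).image (fun q => insert q.1 q.2) := by
    intro e he
    rw [HnkFamilyOdd, Finset.mem_filter, Finset.mem_powerset] at he
    obtain ⟨heT, her, heA⟩ := he
    rw [Finset.mem_union]
    rcases Nat.lt_or_ge (e \ A).card 1 with h | h
    · left
      rw [Nat.lt_one_iff, Finset.card_eq_zero, Finset.sdiff_eq_empty_iff_subset] at h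
      exact Finset.mem_powersetCard.2 ⟨h, her⟩
    · right
      obtain ⟨b, hb⟩ := Finset.card_eq_one.1 (le_antisymm heA h)
      have hbe : b ∈ e \ A := by rw [hb]; simp
      rw [Finset.mem_sdiff] at hbe
      refine Finset.mem_image.2 ⟨(b, e.erase b), Finset.mem_product.2 ⟨?_, ?_⟩,
        Finset.insert_erase hbe.1⟩
      · exact Finset.mem_sdiff.2 ⟨heT hbe.1, hbe.2⟩
      · refine Finset.mem_powersetCard.2 ⟨?_, by rw [Finset.card_erase_of_mem hbe.1, her]⟩
        intro z hz
        rw [Finset.mem_erase] at hz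
        by_contra hzA
        have : z ∈ e \ A := Finset.mem_sdiff.2 ⟨hz.2, hzA⟩
        rw [hb, Finset.mem_singleton] at this
        exact hz.1 this
  refine (Finset.card_le_card hsub).trans ((Finset.card_union_le _ _).trans ?_)
  have h1 := Finset.card_image_le (s := (T \ A) ×ˢ Finset.powersetCard (r - 1) A)
    (f := fun q => insert q.1 q.2)
  rw [Finset.card_product, Finset.card_powersetCard, Finset.card_sdiff_of_subset hA,
    Nat.mul_comm] at h1
  rw [Finset.card_powersetCard]
  omega

theorem card_HnkFamilyEven_le (r : ℕ) (hr : 2 ≤ r) {T A : Finset V} (hA : A ⊆ T) {b1 b2 : V}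
    (hb : b1 ≠ b2) : (HnkFamilyEven r T A b1 b2).card ≤
      A.card.choose (r - 1) * (T.card - A.card) + A.card.choose r + A.card.choose (r - 2) := by
  have hsub : HnkFamilyEven r T A b1 b2 ⊆ HnkFamilyOdd r T A ∪
      (Finset.powersetCard (r - 2) A).image (fun q => {b1, b2} ∪ q) := by
    intro e he
    rw [HnkFamilyEven, Finset.mem_filter] at he
    obtain ⟨heT, her, heA | heA⟩ := he
    · exact Finset.mem_union_left _ (Finset.mem_filter.2 ⟨heT, her, heA⟩)
    · refine Finset.mem_union_right _ (Finset.mem_image.2 ⟨e ∩ A, ?_, ?_⟩)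
      · refine Finset.mem_powersetCard.2 ⟨Finset.inter_subset_right, ?_⟩
        have := Finset.card_inter_add_card_sdiff e A
        rw [heA, Finset.card_pair hb] at this
        omega
      · rw [← heA]
        exact Finset.sdiff_union_inter e A
  refine (Finset.card_le_card hsub).trans ((Finset.card_union_le _ _).trans ?_)
  have h1 := Finset.card_image_le (s := Finset.powersetCard (r - 2) A)
    (f := fun q => {b1, b2} ∪ q)
  have h2 := card_HnkFamilyOdd_le r hA
  rw [Finset.card_powersetCard] at h1
  omega

/-- If the pair graph on `T` has no edges outside `A` except possibly `b1 b2`, the weight of `T` is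
at most the size of the corresponding extremal family, with equality only if that family makes up
everything. -/
theorem PairSystem.weight_le_card_of_core (P : PairSystem H) {r : ℕ} (hr : 3 ≤ r)
    (huni : ∀ e ∈ H, e.card = r) {T A : Finset V} (hA : A ⊆ T) (hrA : r + 3 ≤ A.card)
    {F : Finset (Finset V)} {B : Finset (Finset V)}
    (hF : ∀ e, e ∈ F ↔ e ⊆ T ∧ e.card = r ∧ ((e \ A).card ≤ 1 ∨ e \ A ∈ B))
    (hB : ∀ e ⊆ T, e.card = r → 2 ≤ (e \ A).card →
      (∀ u ∈ e \ A, ∀ v ∈ e \ A, u ≠ v → P.graph.Adj u v) → e \ A ∈ B)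
    (hB' : ∀ u ∈ T \ A, ∀ v ∈ T \ A, P.graph.Adj u v → {u, v} ∈ B) :
    P.weight T ≤ F.card ∧
      (F.card ≤ P.weight T → P.red.filter (· ⊆ T) = ∅ ∧ P.rest.filter (· ⊆ T) = F) := by
  refine P.weight_le_card hr (fun e he => ((hF e).1 he).2.1) ?_ ?_
  · intro e he
    rw [Finset.mem_filter] at he
    have her := huni e (P.rest_sub he.1)
    refine (hF e).2 ⟨he.2, her, ?_⟩
    rcases Nat.lt_or_ge 1 (e \ A).card with h | h
    · refine Or.inr (hB e he.2 her h ?_)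
      intro u hu v hv huv
      refine ⟨huv, Finset.mem_union_right _ (P.pair_blue e he.1 _ ?_ (Finset.card_pair huv))⟩
      intro z hz
      simp only [Finset.mem_insert, Finset.mem_singleton] at hz
      rcases hz with rfl | rfl
      · exact (Finset.mem_sdiff.1 hu).1
      · exact (Finset.mem_sdiff.1 hv).1
    · exact Or.inl h
  · intro p hp hpT
    have hp2 := P.card_red p hp
    refine ⟨A \ p, Finset.disjoint_sdiff, ?_, ?_⟩
    · have := Finset.le_card_sdiff p A
      omega
    · intro Y hY
      rw [Finset.mem_powersetCard] at hY
      have hYA : Y ⊆ A := hY.1.trans Finset.sdiff_subset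
      have hd : Disjoint p Y := Finset.disjoint_sdiff.mono_right hY.1
      have hsd : (p ∪ Y) \ A = p \ A := by
        rw [Finset.union_sdiff_distrib, Finset.sdiff_eq_empty_iff_subset.2 hYA, Finset.union_empty]
      refine (hF _).2 ⟨Finset.union_subset hpT (hYA.trans hA), ?_, ?_⟩
      · rw [Finset.card_union_of_disjoint hd, hp2, hY.2]
        omega
      · rw [hsd]
        rcases Nat.lt_or_ge 1 (p \ A).card with h | h
        · right
          have hpA : p \ A = p := Finset.eq_of_subset_of_card_le Finset.sdiff_subset (by omega)
          obtain ⟨u, v, huv, rfl⟩ := Finset.card_eq_two.1 hp2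
          rw [hpA]
          have hsub : ({u, v} : Finset V) ⊆ T \ A := by
            rw [← hpA]
            exact Finset.sdiff_subset_sdiff hpT subset_rfl
          exact hB' u (hsub (by simp)) v (hsub (by simp)) ⟨huv, Finset.mem_union_left _ hp⟩
        · exact Or.inl h

end Extremal

section Main

variable {V : Type*} [Fintype V] {H : Finset (Finset V)}

theorem PairSystem.eq_of_weight (P : PairSystem H) {F : Finset (Finset V)} {T : Finset V}
    (hT : T.card = Fintype.card V) (hred : P.red.filter (· ⊆ T) = ∅)
    (hrest : P.rest.filter (· ⊆ T) = F) : T = Finset.univ ∧ H = F := by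
  obtain rfl : T = Finset.univ := (Finset.card_eq_iff_eq_univ T).1 hT
  simp only [Finset.subset_univ, Finset.filter_true] at hred hrest
  refine ⟨rfl, ?_⟩
  rw [← hrest]
  refine (Finset.eq_of_subset_of_card_le P.rest_sub ?_).symm
  rw [P.card_eq, hred, Finset.card_empty, Nat.zero_add]

/-- A connected `r`-graph on sufficiently many vertices without a Berge path of length `k` and with
at least the extremal number of hyperedges is extremal. -/
theorem isHnkOn_univ {r s k M : ℕ} (hr : 3 ≤ r) (hrs : r + 3 ≤ s)
    (hk : k = 2 * s + 1 ∨ k = 2 * s + 2) (hM : k + 1 ≤ M) (hMV : M ≤ Fintype.card V)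
    (huni : ∀ e ∈ H, e.card = r) (hconn : HConnected H) (hpath : IsEmpty (BergePath H k))
    (hcard : extremalCount r k (Fintype.card V) ≤ H.card)
    (hV : M.choose r + s.choose (r - 1) * s < Fintype.card V + (s.choose r +
      (if 2 ∣ k then s.choose (r - 2) else 0))) :
    IsHnkOn r k Finset.univ H := by
  obtain ⟨P⟩ := exists_pairSystem H
  have hs : (k - 1) / 2 = s := by omega
  unfold extremalCount at hcard
  rw [hs] at hcard
  set ε := if 2 ∣ k then s.choose (r - 2) else 0 with hε
  have hεe : k = 2 * s + 2 → ε = s.choose (r - 2) ∧ 0 < ε := by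
    intro h
    have h1 : ε = s.choose (r - 2) := by rw [hε, if_pos (by omega)]
    exact ⟨h1, h1 ▸ Nat.choose_pos (by omega)⟩
  have hεo : k = 2 * s + 1 → ε = 0 := fun h => by rw [hε, if_neg (by omega)]
  obtain ⟨T, hMT, hwT, hdeg⟩ := P.exists_dense (M := M) (E := s.choose r + ε) hr hrs (by omega)
    (by omega) hMV huni (by omega) hV
  have hTV := Finset.card_le_univ T
  have hp1 : (s + 1).choose r = s.choose (r - 1) + s.choose r := by
    obtain ⟨q, rfl⟩ : ∃ q, r = q + 1 := ⟨r - 1, by omega⟩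
    exact Nat.choose_succ_succ s q
  have hp2 : (s + 2).choose r = s.choose (r - 2) + 2 * s.choose (r - 1) + s.choose r := by
    obtain ⟨q, rfl⟩ : ∃ q, r = q + 2 := ⟨r - 2, by omega⟩
    have h1 := Nat.choose_succ_succ (s + 1) (q + 1)
    have h2 := Nat.choose_succ_succ s q
    have h3 := Nat.choose_succ_succ s (q + 1)
    simp only [Nat.succ_eq_add_one, Nat.add_assoc, Nat.reduceAdd] at h1 h2 h3 ⊢
    simp only [Nat.add_sub_cancel, show q + 2 - 1 = q + 1 by omega]
    omega
  have hm1 : s.choose (r - 1) * (T.card - s) =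
      s.choose (r - 1) * (T.card - (s + 1)) + s.choose (r - 1) := by
    rw [show T.card - s = (T.card - (s + 1)) + 1 by omega, Nat.mul_succ]
  have hm2 : s.choose (r - 1) * (T.card - s) =
      s.choose (r - 1) * (T.card - (s + 2)) + 2 * s.choose (r - 1) := by
    rw [show T.card - s = (T.card - (s + 2)) + 2 by omega, Nat.mul_add, Nat.mul_comm _ 2]
  rcases P.structure_of_dense hr hrs hk huni hconn hpath (by omega) hdeg
      (fun h => by have := hεe h; omega) with
    ⟨hk2, C, hC, hCw⟩ | ⟨C, ⟨hk2, hC⟩ | ⟨hk2, hC⟩, hCw⟩ | ⟨A, hAT, hA, hcore⟩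
  · have h1 := P.weight_le_choose hr huni (U := C) (by omega)
    have h2 := hεe hk2
    rw [hC] at h1
    omega
  · have h1 := P.weight_le_choose hr huni (U := C) (by omega)
    rw [hC] at h1 hCw
    omega
  · have h1 := P.weight_le_choose hr huni (U := C) (by omega)
    have h2 := hεe hk2
    rw [hC] at h1 hCw
    omega
  have hodd := card_HnkFamilyOdd_le r hAT
  rw [hA] at hodd
  rcases hcore with hcore | ⟨hk2, b1, hb1, b2, hb2, hne, hcore⟩
  · obtain ⟨h1, h2⟩ := P.weight_le_card_of_core hr huni hAT (by omega) (F := HnkFamilyOdd r T A)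
      (B := ∅) (fun e => by simp [HnkFamilyOdd])
      (by
        intro e heT _ he2 hadj
        obtain ⟨u, hu, v, hv, huv⟩ := Finset.one_lt_card.1 he2
        exact absurd (hcore u (Finset.sdiff_subset_sdiff heT subset_rfl hu) v
          (heT (Finset.mem_sdiff.1 hv).1) (hadj u hu v hv huv)) (Finset.mem_sdiff.1 hv).2)
      (by
        intro u hu v hv huv
        exact absurd (hcore u hu v (Finset.mem_sdiff.1 hv).1 huv) (Finset.mem_sdiff.1 hv).2)
    have hk1 : k = 2 * s + 1 := hk.resolve_right fun h => by have := hεe h; omega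
    obtain ⟨h3, h4⟩ := h2 (by omega)
    obtain ⟨rfl, hH⟩ := P.eq_of_weight (by omega) h3 h4
    exact ⟨A, hAT, hA.trans hs.symm, Or.inl ⟨⟨s, hk1⟩, hH⟩⟩
  · have heven := card_HnkFamilyEven_le r (by omega) hAT hne
    rw [hA] at heven
    have hend : ∀ u ∈ T \ A, ∀ v ∈ T \ A, P.graph.Adj u v → u ∈ ({b1, b2} : Finset V) := by
      intro u hu v hv huv
      rw [Finset.mem_sdiff] at hv
      by_contra hcon
      simp only [Finset.mem_insert, Finset.mem_singleton, not_or] at hcon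
      exact hv.2 (hcore u hu hcon.1 hcon.2 v hv.1 huv)
    obtain ⟨h1, h2⟩ := P.weight_le_card_of_core hr huni hAT (by omega)
      (F := HnkFamilyEven r T A b1 b2) (B := {{b1, b2}}) (fun e => by simp [HnkFamilyEven])
      (by
        intro e heT _ he2 hadj
        have hsub := Finset.sdiff_subset_sdiff heT (subset_refl A)
        rw [Finset.mem_singleton]
        refine Finset.eq_of_subset_of_card_le ?_ (by rwa [Finset.card_pair hne])
        intro u hu
        obtain ⟨v, hv, hvu⟩ := Finset.exists_mem_ne he2 u
        exact hend u (hsub hu) v (hsub hv) (hadj u hu v hv hvu.symm))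
      (by
        intro u hu v hv huv
        rw [Finset.mem_singleton]
        refine Finset.eq_of_subset_of_card_le ?_
          (by rw [Finset.card_pair hne, Finset.card_pair huv.ne])
        intro z hz
        rw [Finset.mem_insert, Finset.mem_singleton] at hz
        rcases hz with rfl | rfl
        · exact hend z hu v hv huv
        · exact hend z hv u hu huv.symm)
    have hε2 := hεe hk2
    obtain ⟨h3, h4⟩ := h2 (by omega)
    obtain ⟨rfl, hH⟩ := P.eq_of_weight (by omega) h3 h4
    exact ⟨A, hAT, hA.trans hs.symm, Or.inr ⟨⟨s + 1, by omega⟩, b1, hb1, b2, hb2, hne, hH⟩⟩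

theorem choose_le_hdeg_of_subset {r : ℕ} (hr : 1 ≤ r) {A : Finset V}
    (hA : A.card < Fintype.card V) (hH : HnkFamilyOdd r Finset.univ A ⊆ H) (v : V) :
    A.card.choose (r - 1) ≤ hdeg H v := by
  obtain ⟨b, hb, hvb⟩ : ∃ b, b ∉ A ∧ v ∈ insert b A := by
    by_cases hv : v ∈ A
    · obtain ⟨b, hb⟩ : ∃ b, b ∉ A := by
        by_contra hcon
        push Not at hcon
        rw [Finset.eq_univ_iff_forall.2 hcon, Finset.card_univ] at hA
        omega
      exact ⟨b, hb, Finset.mem_insert_of_mem hv⟩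
    · exact ⟨v, hv, Finset.mem_insert_self v A⟩
  have hcard : ((insert b A).erase v).card = A.card := by
    rw [Finset.card_erase_of_mem hvb, Finset.card_insert_of_notMem hb, Nat.add_sub_cancel]
  rw [← hcard, ← Finset.card_powersetCard]
  refine Finset.card_le_card_of_injOn (fun Y => insert v Y) ?_ ?_
  · intro Y hY
    rw [Finset.mem_coe, Finset.mem_powersetCard] at hY
    have hvY : v ∉ Y := fun h => (Finset.mem_erase.1 (hY.1 h)).1 rfl
    rw [Finset.mem_coe, Finset.mem_filter]
    refine ⟨hH (Finset.mem_filter.2 ⟨by simp, ?_, ?_⟩), by simp⟩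
    · rw [Finset.card_insert_of_notMem hvY, hY.2]
      omega
    · rw [← Finset.card_singleton b]
      refine Finset.card_le_card fun z hz => ?_
      rw [Finset.mem_sdiff, Finset.mem_insert] at hz
      have hz' : z ∈ insert b A := by
        rcases hz.1 with rfl | h
        · exact hvb
        · exact (Finset.mem_erase.1 (hY.1 h)).2
      exact Finset.mem_singleton.2 ((Finset.mem_insert.1 hz').resolve_right hz.2)
  · intro Y hY Y' hY' h
    rw [Finset.mem_coe, Finset.mem_powersetCard] at hY hY'
    have hvY : v ∉ Y := fun h => (Finset.mem_erase.1 (hY.1 h)).1 rfl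
    have hvY' : v ∉ Y' := fun h => (Finset.mem_erase.1 (hY'.1 h)).1 rfl
    rw [← Finset.erase_insert hvY, ← Finset.erase_insert hvY']
    exact congrArg (fun e => e.erase v) h

theorem restrictTo_univ (H : Finset (Finset V)) : restrictTo H Finset.univ = H := by
  simp [restrictTo]

theorem IsHnkOn.choose_le_hdeg {r k : ℕ} (hr : 1 ≤ r) (hk : (k - 1) / 2 < Fintype.card V)
    (hH : IsHnkOn r k Finset.univ H) (v : V) : ((k - 1) / 2).choose (r - 1) ≤ hdeg H v := by
  obtain ⟨A, -, hA, hAH⟩ := hH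
  rw [← hA] at hk ⊢
  refine choose_le_hdeg_of_subset hr hk ?_ v
  rcases hAH with ⟨-, rfl⟩ | ⟨-, b1, -, b2, -, -, rfl⟩
  · exact subset_rfl
  · intro e he
    rw [HnkFamilyOdd, Finset.mem_filter] at he
    exact Finset.mem_filter.2 ⟨he.1, he.2.1, Or.inl he.2.2⟩

end Main

/-- Under the standing assumptions, the sub-hypergraph `H'` obtained by
the deletion process is (isomorphic to) `H_{v(H'),k}` on its vertex set `S`. -/
theorem residual_is_Hnk
    (r k n : ℕ) (hk : 2 * r + 13 ≤ k) (hr : 18 ≤ 2 * r + 13) (hn : Nkr r k < n)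
    (H : Finset (Finset (Fin n))) (huni : ∀ e ∈ H, e.card = r)
    (hconn : HConnected H) (hpath : IsEmpty (BergePath H k))
    (hcard : extremalCount r k n ≤ H.card)
    (S : Finset (Fin n))
    (hS : DelProcess H (((k - 1) / 2).choose (r - 1)) Finset.univ S)
    (hterm : ∀ v ∈ S, ((k - 1) / 2).choose (r - 1) ≤ hdeg (restrictTo H S) v)
    :
    IsHnkOn r k S (restrictTo H S) := by
  have hs : k = 2 * ((k - 1) / 2) + 1 ∨ k = 2 * ((k - 1) / 2) + 2 := by omega
  have hM : 3 * (k - 1) ≤ r * (k - 1) := Nat.mul_le_mul_right _ (by omega)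
  have hH : IsHnkOn r k Finset.univ H := by
    unfold Nkr at hn
    refine isHnkOn_univ (M := r * (k - 1)) (by omega) (by omega) hs (by omega) ?_ huni hconn hpath
      (by rwa [Fintype.card_fin]) ?_
    · rw [Fintype.card_fin]
      omega
    · rw [Fintype.card_fin]
      omega
  obtain rfl : S = Finset.univ := by
    cases hS with
    | refl => rfl
    | step _ _ v _ hd _ =>
      rw [restrictTo_univ] at hd
      refine absurd (hH.choose_le_hdeg (by omega) ?_ v) (by omega)
      rw [Fintype.card_fin]
      unfold Nkr at hn
      omega
  rwa [restrictTo_univ]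
end

section
/- For all integers n and k with n ≥ k ≥ 3, every simple graph on n vertices containing no cycle of length at least k has at most (k−1)(n−1)/2 edges. -/
open scoped Classical

namespace SimpleGraph

variable {V : Type*} {G : SimpleGraph V}

/-- A path whose first and last vertices are adjacent closes up to a cycle. -/
theorem exists_isCycle_of_isChain {v w : V} {a : List V} (ha : 2 ≤ (v :: a).length)
    (hc : (v :: a ++ [w]).IsChain G.Adj) (hn : (v :: a ++ [w]).Nodup) (hvw : G.Adj v w) :
    ∃ (u : V) (c : G.Walk u u), c.IsCycle ∧ c.length = a.length + 2 := by
  obtain ⟨p, hp⟩ : ∃ p : G.Walk v w, p.support = v :: a ++ [w] := by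
    have hne : v :: a ++ [w] ≠ [] := List.cons_ne_nil _ _
    refine ⟨(Walk.ofSupport _ hne hc).copy (by simp) (by simp), ?_⟩
    exact (Walk.support_copy ..).trans (Walk.support_ofSupport hne hc)
  have hlen : p.length = a.length + 1 := by
    have := p.length_support
    rw [hp] at this
    simpa using this.symm
  have hpath : p.IsPath := by rw [Walk.isPath_def, hp]; exact hn
  refine ⟨w, Walk.cons hvw.symm p, ?_, by simp [hlen]⟩
  rw [Walk.cons_isCycle_iff]
  refine ⟨hpath, fun h => ?_⟩
  rw [Sym2.eq_swap] at h
  have := hpath.length_eq_one_of_mem_edges h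
  simp only [List.length_cons] at ha
  omega

/-- The vertex list `l` traces a path of `G` inside the vertex set `A`. -/
structure IsPathIn (G : SimpleGraph V) (A : Finset V) (l : List V) : Prop where
  isChain : l.IsChain G.Adj
  nodup : l.Nodup
  subset : ∀ x ∈ l, x ∈ A

namespace IsPathIn

variable {A : Finset V} {l a b t : List V} {v w s : V}

theorem length_le (h : G.IsPathIn A l) : l.length ≤ A.card := by
  rw [← List.toFinset_card_of_nodup h.nodup]
  exact Finset.card_le_card fun x hx => h.subset x (List.mem_toFinset.mp hx)

/-- Pósa rotation: reverse the initial segment of a path ending just before a neighbour of its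
first vertex. -/
theorem rotate (h : G.IsPathIn A (v :: t)) (hl : v :: t = a ++ s :: w :: b) (hvw : G.Adj v w) :
    G.IsPathIn A (s :: (a.reverse ++ w :: b)) := by
  have hperm : (s :: (a.reverse ++ w :: b)).Perm (v :: t) := by
    rw [hl]
    exact (List.perm_middle.symm.trans ((List.reverse_perm a).append_right _))
  refine ⟨?_, hperm.nodup_iff.mpr h.nodup, fun x hx => h.subset x (hperm.mem_iff.mp hx)⟩
  have hl' : v :: t = (a ++ [s]) ++ w :: b := by simpa using hl
  have hc := h.isChain
  rw [hl', List.isChain_append] at hc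
  have heq : s :: (a.reverse ++ w :: b) = (a ++ [s]).reverse ++ w :: b := by simp
  rw [heq, List.isChain_append, List.isChain_reverse]
  refine ⟨hc.1.imp fun _ _ => Adj.symm, hc.2.1, ?_⟩
  have hhead : (a ++ [s]).head? = some v := by
    cases a with
    | nil => simp at hl ⊢; exact hl.1.symm
    | cons y a => simp at hl ⊢; exact hl.1.symm
  intro x hx y hy
  simp only [List.getLast?_reverse, hhead, Option.mem_some_iff, List.head?_cons] at hx hy
  exact hx ▸ hy ▸ hvw

/-- If `G` has no cycle of length at least `k` and lives on `A`, then all neighbours of the first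
vertex of a longest path lie among the first `k - 1` vertices of that path. -/
theorem adj_mem_take {k : ℕ} (hk : 3 ≤ k)
    (hcyc : ¬ ∃ (u : V) (c : G.Walk u u), c.IsCycle ∧ k ≤ c.length)
    (hA : ∀ x y, G.Adj x y → x ∈ A) (h : G.IsPathIn A (v :: t))
    (hmax : ∀ l, G.IsPathIn A l → l.length ≤ (v :: t).length) (hvw : G.Adj v w) :
    ∃ a b, v :: t = v :: a ++ w :: b ∧ (v :: a).length < k - 1 := by
  have hw : w ∈ v :: t := by
    by_contra hw
    have := hmax (w :: v :: t) ⟨List.isChain_cons_cons.mpr ⟨hvw.symm, h.isChain⟩,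
      List.nodup_cons.mpr ⟨hw, h.nodup⟩, by
        intro x hx
        rcases List.mem_cons.mp hx with rfl | hx
        · exact hA _ _ hvw.symm
        · exact h.subset x hx⟩
    simp at this
  have hwt : w ∈ t := (List.mem_cons.mp hw).resolve_left hvw.ne'
  obtain ⟨a, b, rfl⟩ := List.append_of_mem hwt
  refine ⟨a, b, rfl, ?_⟩
  by_contra! hlen
  have hsub : (v :: a ++ [w]) <+: (v :: (a ++ w :: b)) := ⟨b, by simp⟩
  obtain ⟨u, c, hc, hcl⟩ := exists_isCycle_of_isChain (by omega)
    (h.isChain.prefix hsub) (h.nodup.sublist hsub.sublist) hvw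
  refine hcyc ⟨u, c, hc, ?_⟩
  simp only [List.length_cons] at hlen
  omega

end IsPathIn

/-- Deleting the edges meeting `S`, when all vertices of `S` have degree at most `#S` and all
their neighbours lie in a set `T ⊇ S`, costs at most `#S * #T / 2` edges. -/
theorem two_mul_card_edgeFinset_le_add [Fintype V] {H : SimpleGraph V} {S T : Finset V}
    (hH : ∀ x y, H.Adj x y ↔ G.Adj x y ∧ x ∉ S ∧ y ∉ S) (hST : S ⊆ T)
    (hdeg : ∀ s ∈ S, G.degree s ≤ S.card) (hN : ∀ s ∈ S, ∀ w, G.Adj s w → w ∈ T) :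
    2 * G.edgeFinset.card ≤ 2 * H.edgeFinset.card + S.card * T.card := by
  have hout : ∑ v ∈ Sᶜ, G.degree v ≤ ∑ v, H.degree v + ∑ s ∈ S, (Sᶜ.filter (G.Adj s)).card := by
    have hswap : ∑ s ∈ S, (Sᶜ.filter (G.Adj s)).card =
        ∑ v ∈ Sᶜ, (S.filter fun s => G.Adj s v).card :=
      Finset.sum_card_bipartiteAbove_eq_sum_card_bipartiteBelow _
    rw [hswap]
    refine le_trans ?_ (Nat.add_le_add_right
      (Finset.sum_le_sum_of_subset (Finset.subset_univ Sᶜ)) _)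
    rw [← Finset.sum_add_distrib]
    refine Finset.sum_le_sum fun v hv => ?_
    rw [← card_neighborFinset_eq_degree, ← card_neighborFinset_eq_degree]
    refine le_trans (Finset.card_le_card fun w hw => ?_) (Finset.card_union_le _ _)
    rw [mem_neighborFinset] at hw
    simp only [Finset.mem_union, mem_neighborFinset, Finset.mem_filter, hH]
    by_cases hwS : w ∈ S
    · exact Or.inr ⟨hwS, hw.symm⟩
    · exact Or.inl ⟨hw, Finset.mem_compl.mp hv, hwS⟩
  have hin : ∑ v ∈ S, (G.degree v + (Sᶜ.filter (G.Adj v)).card) ≤ S.card * T.card := by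
    rw [← smul_eq_mul]
    refine Finset.sum_le_card_nsmul _ _ _ fun s hs => ?_
    have hsub : Sᶜ.filter (G.Adj s) ⊆ T \ S := fun w hw => by
      rw [Finset.mem_filter, Finset.mem_compl] at hw
      exact Finset.mem_sdiff.mpr ⟨hN s hs w hw.2, hw.1⟩
    have := Finset.card_le_card hsub
    rw [← Finset.card_sdiff_add_card_eq_card hST]
    have := hdeg s hs
    omega
  rw [← sum_degrees_eq_twice_card_edges, ← sum_degrees_eq_twice_card_edges,
    ← Finset.sum_add_sum_compl S]
  rw [Finset.sum_add_distrib] at hin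
  omega

/-- Among the longest paths in `A`, one whose first vertex has maximum degree. -/
theorem exists_longest_isPathIn [Fintype V] {A : Finset V} {x y : V} (hxy : G.Adj x y)
    (hA : ∀ x y, G.Adj x y → x ∈ A) :
    ∃ v t, G.IsPathIn A (v :: t) ∧ 0 < G.degree v ∧
      (∀ l, G.IsPathIn A l → l.length ≤ (v :: t).length) ∧
      ∀ u l, G.IsPathIn A (u :: l) → l.length = t.length → G.degree u ≤ G.degree v := by
  have hpair : G.IsPathIn A [x, y] :=
    ⟨by simpa using hxy, by simpa using hxy.ne, by simp [hA _ _ hxy, hA _ _ hxy.symm]⟩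
  have hfin : {l | G.IsPathIn A l}.Finite :=
    (List.finite_length_le V A.card).subset fun l hl => hl.length_le
  obtain ⟨l₀, hl₀, hlong⟩ := Set.exists_max_image _ List.length hfin ⟨_, hpair⟩
  obtain ⟨l, ⟨hl, hlen⟩, hdeg⟩ := Set.exists_max_image
    {l | G.IsPathIn A l ∧ l.length = l₀.length} (fun l => l.head?.elim 0 fun v => G.degree v)
    (hfin.subset fun l hl => hl.1) ⟨l₀, hl₀, rfl⟩
  have htwo := hlong _ hpair
  rw [← hlen] at htwo hlong hdeg
  match l, hl, htwo, hlong, hdeg with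
  | v :: z :: t, hl, _, hlong, hdeg =>
    refine ⟨v, z :: t, hl, ?_, hlong, fun u l hu hul => ?_⟩
    · exact (G.degree_pos_iff_exists_adj v).mpr ⟨z, (List.isChain_cons_cons.mp hl.isChain).1⟩
    · simpa using hdeg (u :: l) ⟨hu, by simpa using hul⟩

/-- In a graph without cycles of length at least `k`, there is a nonempty set `S` of vertices of
degree at most `#S`, all of whose neighbours lie in a set `T ⊇ S` of at most `k - 1` vertices. -/
theorem exists_nonempty_degree_le_card [Fintype V] {A : Finset V} {x y : V} {k : ℕ} (hk : 3 ≤ k)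
    (hcyc : ¬ ∃ (u : V) (c : G.Walk u u), c.IsCycle ∧ k ≤ c.length)
    (hxy : G.Adj x y) (hA : ∀ x y, G.Adj x y → x ∈ A) :
    ∃ S T : Finset V, S.Nonempty ∧ S ⊂ A ∧ S ⊆ T ∧ T.card ≤ k - 1 ∧
      (∀ s ∈ S, G.degree s ≤ S.card) ∧ ∀ s ∈ S, ∀ w, G.Adj s w → w ∈ T := by
  obtain ⟨v, t, hP, hpos, hlong, hdeg⟩ := exists_longest_isPathIn hxy hA
  have hpred : ∀ w : V, ∃ s, G.Adj v w → ∃ a b, v :: t = a ++ s :: w :: b ∧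
      (a ++ [s]).length < k - 1 := by
    intro w
    by_cases hvw : G.Adj v w
    · obtain ⟨a, b, hl, hlen⟩ := hP.adj_mem_take hk hcyc hA hlong hvw
      have hne : v :: a ≠ [] := by simp
      refine ⟨(v :: a).getLast hne, fun _ => ⟨(v :: a).dropLast, b, ?_, ?_⟩⟩
      · rw [hl]
        conv_lhs => rw [← List.dropLast_append_getLast hne]
        simp
      · rwa [List.dropLast_append_getLast hne]
    · exact ⟨v, fun h => absurd h hvw⟩
  choose f hf using hpred
  have hinj : Set.InjOn f (G.neighborFinset v) := by
    intro w hw w' hw' hww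
    simp only [Finset.mem_coe, mem_neighborFinset] at hw hw'
    obtain ⟨a, b, hl, -⟩ := hf w hw
    obtain ⟨a', b', hl', -⟩ := hf w' hw'
    rw [← hww] at hl'
    have hn := hP.nodup
    rw [hl] at hn hl'
    have hlen : a.length = a'.length := by
      have h₁ : (a ++ f w :: w :: b).idxOf (f w) = a.length := by
        grind [List.nodup_append]
      have h₂ : (a' ++ f w :: w' :: b').idxOf (f w) = a'.length := by
        rw [hl'] at hn
        grind [List.nodup_append]
      rw [← h₁, ← h₂, hl']
    have := List.append_inj_right hl' hlen
    simp at this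
    exact this.1
  have hcard : ((G.neighborFinset v).image f).card = G.degree v := by
    rw [Finset.card_image_of_injOn hinj, card_neighborFinset_eq_degree]
  have hmem : ∀ s ∈ (G.neighborFinset v).image f, ∃ w a b, G.Adj v w ∧
      v :: t = a ++ s :: w :: b ∧ (a ++ [s]).length < k - 1 := by
    intro s hs
    obtain ⟨w, hw, rfl⟩ := Finset.mem_image.mp hs
    rw [mem_neighborFinset] at hw
    obtain ⟨a, b, h⟩ := hf w hw
    exact ⟨w, a, b, hw, h⟩
  have hSA : (G.neighborFinset v).image f ⊆ A := by
    intro s hs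
    obtain ⟨w, a, b, -, hl, -⟩ := hmem s hs
    exact hP.subset s (by simp [hl])
  refine ⟨(G.neighborFinset v).image f, ((v :: t).take (k - 1)).toFinset, ?_, ?_, ?_, ?_, ?_, ?_⟩
  · rw [← Finset.card_pos, hcard]; exact hpos
  · refine hSA.ssubset_of_ne fun h => ?_
    have hlt : (G.neighborFinset v).card < A.card := by
      refine Finset.card_lt_card ⟨fun w hw => ?_, fun hsub => ?_⟩
      · exact hA w v ((mem_neighborFinset ..).mp hw).symm
      · exact G.irrefl ((mem_neighborFinset ..).mp (hsub (hP.subset v (by simp))))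
    rw [card_neighborFinset_eq_degree, ← hcard, h] at hlt
    exact lt_irrefl _ hlt
  · intro s hs
    obtain ⟨w, a, b, -, hl, hlen⟩ := hmem s hs
    have : v :: t = (a ++ [s]) ++ w :: b := by simp [hl]
    rw [this, List.take_append, List.take_of_length_le hlen.le]
    simp
  · exact (List.toFinset_card_le _).trans (List.length_take_le _ _)
  · intro s hs
    obtain ⟨w, a, b, hvw, hl, -⟩ := hmem s hs
    rw [hcard]
    refine hdeg s _ (hP.rotate hl hvw) ?_
    have := congrArg List.length hl
    simp at this ⊢
    omega
  · intro s hs z hsz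
    obtain ⟨w, a, b, hvw, hl, hlen⟩ := hmem s hs
    have hR := hP.rotate hl hvw
    have hlen' : (s :: (a.reverse ++ w :: b)).length = (v :: t).length := by
      rw [hl]; simp; omega
    obtain ⟨c, d, hcd, hclen⟩ := hR.adj_mem_take hk hcyc hA (hlen' ▸ hlong) hsz
    have hz : z ∈ (s :: (a.reverse ++ w :: b)).take (k - 1) := by
      have : s :: c ++ z :: d = (s :: c ++ [z]) ++ d := by simp
      rw [hcd, this, List.take_append, List.take_of_length_le (by simp at hclen ⊢; omega)]
      simp
    have h₁ : v :: t = (a ++ [s]) ++ w :: b := by simp [hl]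
    have h₂ : s :: (a.reverse ++ w :: b) = (a ++ [s]).reverse ++ w :: b := by simp
    rw [h₂, List.take_append, List.take_of_length_le (by simpa using hlen.le)] at hz
    rw [h₁, List.take_append, List.take_of_length_le hlen.le]
    simpa using hz

/-- A graph living on a nonempty vertex set `A` and having no cycle of length at least `k` has
at most `(k - 1) * (#A - 1) / 2` edges. -/
theorem two_mul_card_edgeFinset_le_of_no_long_cycle [Fintype V] {k : ℕ} (hk : 3 ≤ k)
    (A : Finset V) (hne : A.Nonempty) (G : SimpleGraph V)
    (hcyc : ¬ ∃ (u : V) (c : G.Walk u u), c.IsCycle ∧ k ≤ c.length)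
    (hA : ∀ x y, G.Adj x y → x ∈ A) :
    2 * G.edgeFinset.card ≤ (k - 1) * (A.card - 1) := by
  induction A using Finset.strongInduction generalizing G with
  | H A ih =>
    by_cases hG : ∃ x y, G.Adj x y
    · obtain ⟨x, y, hxy⟩ := hG
      obtain ⟨S, T, hS, hSA, hST, hT, hdeg, hN⟩ := exists_nonempty_degree_le_card hk hcyc hxy hA
      obtain ⟨H, hH⟩ : ∃ H : SimpleGraph V, ∀ x y, H.Adj x y ↔ G.Adj x y ∧ x ∉ S ∧ y ∉ S :=
        ⟨(G.induce (S : Set V)ᶜ).spanningCoe, fun x y => by simp⟩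
      have hHG : H ≤ G := fun x y h => ((hH x y).mp h).1
      have hrec := ih (A \ S) (Finset.sdiff_ssubset hSA.subset hS)
        (Finset.sdiff_nonempty.mpr hSA.not_subset) H
        (fun ⟨u, c, hc, hlen⟩ => hcyc ⟨u, c.mapLe hHG, hc.mapLe hHG, by simpa using hlen⟩)
        (fun x y h => Finset.mem_sdiff.mpr ⟨hA x y ((hH x y).mp h).1, ((hH x y).mp h).2.1⟩)
      have hstep := two_mul_card_edgeFinset_le_add hH hST hdeg hN
      have hcard := Finset.card_sdiff_add_card_eq_card hSA.subset
      have hpos := (Finset.sdiff_nonempty.mpr hSA.not_subset).card_pos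
      have hA' : A.card - 1 = (A \ S).card - 1 + S.card := by omega
      calc 2 * G.edgeFinset.card ≤ 2 * H.edgeFinset.card + S.card * T.card := hstep
        _ ≤ (k - 1) * ((A \ S).card - 1) + S.card * (k - 1) :=
          Nat.add_le_add hrec (Nat.mul_le_mul_left _ hT)
        _ = (k - 1) * (A.card - 1) := by rw [hA']; ring
    · have : G.edgeFinset = ∅ := by
        rw [edgeFinset_eq_empty]
        ext x y
        simpa using fun h => hG ⟨x, y, h⟩
      simp [this]

end SimpleGraph

/-- Erdős–Gallai. For `n ≥ k ≥ 3`, every simple graph on `n` vertices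
with no cycle of length at least `k` has at most `(k−1)(n−1)/2` edges. -/
theorem erdos_gallai_cycle
    (n k : ℕ) (hk : 3 ≤ k) (hkn : k ≤ n) (G : SimpleGraph (Fin n)) [DecidableRel G.Adj]
    (hcyc : ¬ ∃ (u : Fin n) (c : G.Walk u u), c.IsCycle ∧ k ≤ c.length) :
    2 * G.edgeFinset.card ≤ (k - 1) * (n - 1) := by
  have := SimpleGraph.two_mul_card_edgeFinset_le_of_no_long_cycle hk Finset.univ
    (Finset.univ_nonempty_iff.mpr ⟨⟨0, by omega⟩⟩) G hcyc (by simp)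
  rw [Finset.card_univ, Fintype.card_fin] at this
  convert this
end
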